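/- Let d ≥ 2 and assume a complete set of d+1 mutually unbiased bases exists in ℂ^d, with complete MUB ensemble M. Let S be any labelled union of d+1 orthonormal bases of ℂ^d (counting basis membership with multiplicity), and let H be a standard isotropic Gaussian Hamiltonian on ℂ^d. Then for every t ∈ ℝ, P( max_{ψ∈S} Tr(H Q_ψ) ≤ t ) ≥ P( max_{ψ∈M} Tr(H Q_ψ) ≤ t ); that is, the maximum over M stochastically dominates the maximum over any union of d+1 orthonormal bases. -/

import Mathlib

open MeasureTheory ProbabilityTheory Matrix

noncomputable section

/-- The centered projection `Q_ψ = |ψ⟩⟨ψ| − I/d` associated to a vector `ψ ∈ ℂ^d`. -/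
def Qmat {d : ℕ} (ψ : Fin d → ℂ) : Matrix (Fin d) (Fin d) ℂ :=
  Matrix.vecMulVec ψ (star ψ) - (d : ℂ)⁻¹ • (1 : Matrix (Fin d) (Fin d) ℂ)

/-- `B` is an orthonormal basis of `ℂ^d` (as a `d`-tuple of vectors). -/
def IsONB {d : ℕ} (B : Fin d → Fin d → ℂ) : Prop :=
  ∀ i j, star (B i) ⬝ᵥ B j = if i = j then (1 : ℂ) else 0

/-- `B` is a complete system of `d+1` mutually unbiased bases of `ℂ^d`. -/
def IsCompleteMUB {d : ℕ} (B : Fin (d + 1) → Fin d → Fin d → ℂ) : Prop :=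
  (∀ a, IsONB (B a)) ∧
    ∀ a b i j, a ≠ b → Complex.normSq (star (B a i) ⬝ᵥ B b j) = 1 / d

/-- `H` is a standard isotropic Gaussian Hamiltonian on `ℂ^d` under the probability
measure `μ`: it is `∑ k, g k • E k` for an orthonormal basis `E` of the real space of
traceless Hermitian `d×d` matrices (Hilbert–Schmidt inner product) and i.i.d. standard
real Gaussians `g k`. -/
def IsStdGaussianHamiltonian {d : ℕ} {Ω : Type*} [MeasurableSpace Ω]
    (μ : Measure Ω) (H : Ω → Matrix (Fin d) (Fin d) ℂ) : Prop :=
  ∃ (E : Fin (d ^ 2 - 1) → Matrix (Fin d) (Fin d) ℂ)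
    (g : Fin (d ^ 2 - 1) → Ω → ℝ),
      (∀ k, (E k).IsHermitian) ∧
      (∀ k, (E k).trace = 0) ∧
      (∀ k l, (E k * E l).trace = if k = l then (1 : ℂ) else 0) ∧
      Measurable (fun ω k => g k ω) ∧
      Measure.map (fun ω k => g k ω) μ =
        Measure.pi (fun _ : Fin (d ^ 2 - 1) => gaussianReal 0 1) ∧
      ∀ ω, H ω = ∑ k, (g k ω : ℂ) • E k

section
variable {ι κ : Type*} [Fintype ι] [Fintype κ]

/-- The measure `μ` is the centered Gaussian law with covariance matrix `C`. -/
structure HasGauss (μ : Measure (ι → ℝ)) (C : Matrix ι ι ℝ) : Prop where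
  prob : IsProbabilityMeasure μ
  charFun_eq : ∀ t : ι → ℝ, ∫ x, Complex.exp ((t ⬝ᵥ x : ℝ) * Complex.I) ∂μ =
    Complex.exp (((-(t ⬝ᵥ C *ᵥ t) / 2 : ℝ) : ℂ))

/-- The standard Gaussian law on `ι → ℝ`. -/
abbrev stdG (ι : Type*) [Fintype ι] : Measure (ι → ℝ) :=
  Measure.pi (fun _ : ι => gaussianReal 0 1)

lemma HasGauss.ext {μ ν : Measure (ι → ℝ)} {C : Matrix ι ι ℝ} (hμ : HasGauss μ C)
    (hν : HasGauss ν C) : μ = ν := by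
  classical
  have := hμ.prob
  have := hν.prob
  apply Measure.ext_of_charFunDual
  ext L
  have key : ∀ x : ι → ℝ, L x = (fun i => L (Pi.single i 1 : ι → ℝ)) ⬝ᵥ x := by
    intro x
    conv_lhs => rw [pi_eq_sum_univ' x]
    simp [dotProduct, map_sum, mul_comm]
  rw [charFunDual_apply, charFunDual_apply]
  generalize (fun i => L (Pi.single i 1 : ι → ℝ)) = t at key
  simp_rw [key]
  rw [hμ.charFun_eq, hν.charFun_eq]

lemma HasGauss.map {μ : Measure (ι → ℝ)} {C : Matrix ι ι ℝ} (hμ : HasGauss μ C)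
    (M : Matrix κ ι ℝ) : HasGauss (μ.map (M *ᵥ ·)) (M * C * Mᵀ) := by
  have := hμ.prob
  have hm : Measurable (fun x : ι → ℝ => M *ᵥ x) := by fun_prop
  refine ⟨Measure.isProbabilityMeasure_map hm.aemeasurable, fun t => ?_⟩
  rw [integral_map hm.aemeasurable (by fun_prop)]
  have := hμ.charFun_eq (t ᵥ* M)
  simp_rw [← dotProduct_mulVec] at this
  rw [this, ← mulVec_mulVec, ← mulVec_mulVec, mulVec_transpose]

lemma hasGauss_stdG [DecidableEq ι] : HasGauss (stdG ι) (1 : Matrix ι ι ℝ) := by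
  refine ⟨inferInstance, fun t => ?_⟩
  simp only [dotProduct, one_mulVec]
  push_cast
  simp_rw [Finset.sum_mul, Complex.exp_sum]
  rw [integral_fintype_prod_eq_prod (fun i (x : ℝ) => Complex.exp (t i * x * Complex.I))]
  rw [neg_div, Finset.sum_div, ← Finset.sum_neg_distrib, Complex.exp_sum]
  refine Finset.prod_congr rfl fun i _ => ?_
  have := charFun_gaussianReal (μ := 0) (v := 1) (t i)
  rw [charFun_apply_real] at this
  rw [this]
  congr 1
  push_cast
  ring

lemma hasGauss_map_stdG (M : Matrix κ ι ℝ) : HasGauss ((stdG ι).map (M *ᵥ ·)) (M * Mᵀ) := by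
  classical
  simpa using (hasGauss_stdG (ι := ι)).map M

open scoped MatrixOrder in
lemma exists_hasGauss {C : Matrix ι ι ℝ} (hC : C.PosSemidef) : ∃ μ, HasGauss μ C := by
  classical
  obtain ⟨A, rfl⟩ := (CStarAlgebra.nonneg_iff_eq_star_mul_self (a := C)).1
    (Matrix.nonneg_iff_posSemidef.2 hC)
  refine ⟨(stdG ι).map (Aᵀ *ᵥ ·), ?_⟩
  have := hasGauss_map_stdG Aᵀ
  simpa [star_eq_conjTranspose] using this

lemma integral_exp_neg_sq_gaussianReal {c : ℝ} (hc : 0 ≤ c) :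
    ∫ x, Real.exp (-(c * x ^ 2) / 2) ∂(gaussianReal 0 1) = (√(1 + c))⁻¹ := by
  rw [integral_gaussianReal_eq_integral_smul (by simp)]
  simp only [gaussianPDFReal, smul_eq_mul]
  have : ∀ x : ℝ, (√(2 * Real.pi * ((1 : NNReal) : ℝ)))⁻¹ *
      Real.exp (-(x - 0) ^ 2 / (2 * ((1 : NNReal) : ℝ))) * Real.exp (-(c * x ^ 2) / 2) =
      (√(2 * Real.pi))⁻¹ * Real.exp (-((1 + c) / 2) * x ^ 2) := by
    intro x
    rw [mul_assoc, ← Real.exp_add]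
    simp only [NNReal.coe_one, mul_one, sub_zero]
    congr 2
    ring
  simp_rw [this]
  rw [integral_const_mul, integral_gaussian, ← Real.sqrt_inv, ← Real.sqrt_inv,
    ← Real.sqrt_mul (by positivity)]
  congr 1
  have := Real.pi_pos
  field_simp

lemma HasGauss.integral_exp_neg_sq [DecidableEq ι] {μ : Measure (ι → ℝ)} {C : Matrix ι ι ℝ}
    (hμ : HasGauss μ C) (hC : C.PosSemidef) :
    ∫ x, Real.exp (-(x ⬝ᵥ x) / 2) ∂μ = (√(1 + C).det)⁻¹ := by
  set U : Matrix ι ι ℝ := (hC.1.eigenvectorUnitary : Matrix ι ι ℝ) with hU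
  set ev := hC.1.eigenvalues with hev
  have hUU : Uᵀ * U = 1 := by
    have := Unitary.coe_star_mul_self hC.1.eigenvectorUnitary
    simpa [star_eq_conjTranspose] using this
  have hUU' : U * Uᵀ = 1 := mul_eq_one_comm.1 hUU
  have hspec : C = U * diagonal ev * Uᵀ := by
    have := hC.1.spectral_theorem
    rw [Unitary.conjStarAlgAut_apply] at this
    simpa [star_eq_conjTranspose] using this
  have hev0 : ∀ i, 0 ≤ ev i := fun i => hC.eigenvalues_nonneg i
  set M : Matrix ι ι ℝ := U * diagonal (fun i => √(ev i)) with hM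
  have hMM : M * Mᵀ = C := by
    rw [hspec, hM, transpose_mul, diagonal_transpose, Matrix.mul_assoc, Matrix.mul_assoc,
      ← Matrix.mul_assoc (diagonal _) (diagonal _), diagonal_mul_diagonal]
    simp only [Real.mul_self_sqrt (hev0 _)]
  have hlaw : μ = (stdG ι).map (M *ᵥ ·) := hμ.ext (hMM ▸ hasGauss_map_stdG M)
  rw [hlaw, integral_map (by fun_prop) (by fun_prop)]
  have hsq : ∀ y : ι → ℝ, -((M *ᵥ y) ⬝ᵥ (M *ᵥ y)) / 2 = ∑ i, -(ev i * y i ^ 2) / 2 := by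
    intro y
    rw [← Finset.sum_div, Finset.sum_neg_distrib]
    congr 2
    rw [dotProduct_mulVec, vecMul_mulVec, ← dotProduct_mulVec, hM, transpose_mul,
      diagonal_transpose, Matrix.mul_assoc, ← Matrix.mul_assoc Uᵀ, hUU, Matrix.one_mul,
      diagonal_mul_diagonal]
    simp only [Real.mul_self_sqrt (hev0 _), dotProduct, mulVec_diagonal]
    refine Finset.sum_congr rfl fun i _ => ?_
    ring
  simp_rw [hsq, Real.exp_sum]
  rw [integral_fintype_prod_eq_prod (fun i (x : ℝ) => Real.exp (-(ev i * x ^ 2) / 2))]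
  simp_rw [integral_exp_neg_sq_gaussianReal (hev0 _)]
  rw [Finset.prod_inv_distrib, ← Real.sqrt_prod _ (fun i _ => by linarith [hev0 i])]
  congr 2
  have : 1 + C = U * diagonal (fun i => 1 + ev i) * Uᵀ := by
    have : diagonal (fun i => 1 + ev i) = 1 + diagonal ev := by
      rw [← diagonal_one, diagonal_add]
    rw [this, Matrix.mul_add, Matrix.add_mul, Matrix.mul_one, hUU', ← hspec]
  rw [this, det_mul_right_comm, hUU', Matrix.one_mul, det_diagonal]

lemma det_one_add_pos [DecidableEq ι] {C : Matrix ι ι ℝ} (hC : C.PosSemidef) :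
    0 < (1 + C).det :=
  (Matrix.PosDef.one.add_posSemidef hC).det_pos

lemma HasGauss.integral_exp_neg_weighted [DecidableEq ι] {μ : Measure (ι → ℝ)}
    {C : Matrix ι ι ℝ} (hμ : HasGauss μ C) (hC : C.PosSemidef) {w : ι → ℝ} (hw : ∀ i, 0 ≤ w i) :
    0 < (1 + diagonal w * C).det ∧
    ∫ x, Real.exp (-(∑ i, w i * x i ^ 2) / 2) ∂μ = (√(1 + diagonal w * C).det)⁻¹ := by
  set D : Matrix ι ι ℝ := diagonal fun i => √(w i)
  have hDC : (D * C * Dᵀ).PosSemidef := by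
    simpa using hC.mul_mul_conjTranspose_same D
  have hdet : (1 + D * C * Dᵀ).det = (1 + diagonal w * C).det := by
    rw [Matrix.mul_assoc, det_one_add_mul_comm, Matrix.mul_assoc, det_one_add_mul_comm]
    simp only [D, diagonal_transpose, diagonal_mul_diagonal, Real.mul_self_sqrt (hw _)]
  rw [← hdet]
  refine ⟨det_one_add_pos hDC, ?_⟩
  rw [← (hμ.map D).integral_exp_neg_sq hDC, integral_map (by fun_prop) (by fun_prop)]
  congr with x
  congr 3
  simp only [D, dotProduct, mulVec_diagonal]
  refine Finset.sum_congr rfl fun i _ => ?_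
  have := Real.mul_self_sqrt (hw i)
  linear_combination (-x i ^ 2) * this

/-- A centered Gaussian measure on a normed space. -/
structure IsCG {E : Type*} [NormedAddCommGroup E] [NormedSpace ℝ E] [MeasurableSpace E]
    [BorelSpace E] (μ : Measure E) : Prop where
  gauss : IsGaussian μ
  mean : ∀ L : StrongDual ℝ E, ∫ x, L x ∂μ = 0

lemma IsCG.exists_hasGauss {μ : Measure (ι → ℝ)} (hμ : IsCG μ) :
    ∃ C : Matrix ι ι ℝ, C.PosSemidef ∧ HasGauss μ C := by
  have := hμ.gauss
  set C : Matrix ι ι ℝ := fun i j => cov[fun x => x i, fun x => x j; μ] with hCdef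
  have hLp : ∀ i, MemLp (fun x : ι → ℝ => x i) 2 μ := fun i =>
    IsGaussian.memLp_dual μ (ContinuousLinearMap.proj (R := ℝ) (φ := fun _ : ι => ℝ) i) 2 (by simp)
  have hvar : ∀ t : ι → ℝ, Var[fun x => t ⬝ᵥ x; μ] = t ⬝ᵥ C *ᵥ t := by
    intro t
    simp only [dotProduct]
    rw [← covariance_self (Measurable.aemeasurable (by fun_prop))]
    rw [covariance_fun_sum_fun_sum (fun i => (hLp i).const_mul _) (fun i => (hLp i).const_mul _)]
    refine Finset.sum_congr rfl fun i _ => ?_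
    simp only [mulVec, dotProduct, Finset.mul_sum, covariance_const_mul_left,
      covariance_const_mul_right, hCdef]
    refine Finset.sum_congr rfl fun j _ => ?_
    ring
  refine ⟨C, ?_, inferInstance, fun t => ?_⟩
  · refine PosSemidef.of_dotProduct_mulVec_nonneg ?_ fun t => ?_
    · ext i j
      exact covariance_comm _ _
    · simp only [star_trivial]
      rw [← hvar]
      exact variance_nonneg _ _
  · set L : StrongDual ℝ (ι → ℝ) :=
      ∑ i, t i • ContinuousLinearMap.proj (R := ℝ) (φ := fun _ : ι => ℝ) i with hL
    have hLx : ∀ x, L x = t ⬝ᵥ x := by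
      intro x
      simp [hL, dotProduct]
    have h1 := IsGaussian.charFunDual_eq (μ := μ) L
    have h2 := hμ.mean L
    rw [charFunDual_apply] at h1
    have hvL : Var[L; μ] = t ⬝ᵥ C *ᵥ t := by rw [← hvar]; congr 1; ext x; exact hLx x
    rw [integral_complex_ofReal, h2, hvL] at h1
    simp_rw [hLx] at h1
    rw [h1]
    congr 1
    push_cast
    ring

section closure

variable {E F : Type*} [NormedAddCommGroup E] [NormedSpace ℝ E] [MeasurableSpace E]
  [BorelSpace E] [NormedAddCommGroup F] [NormedSpace ℝ F] [MeasurableSpace F] [BorelSpace F]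

lemma IsCG.map {μ : Measure E} (hμ : IsCG μ) (T : E →L[ℝ] F) : IsCG (μ.map T) := by
  have := hμ.gauss
  refine ⟨inferInstance, fun L => ?_⟩
  rw [integral_map (by fun_prop) (by fun_prop)]
  exact hμ.mean (L.comp T)

lemma IsCG.prod [SecondCountableTopology E] [SecondCountableTopology F]
    {μ : Measure E} {ν : Measure F} (hμ : IsCG μ) (hν : IsCG ν) :
    IsCG (μ.prod ν) := by
  have := hμ.gauss
  have := hν.gauss
  refine ⟨inferInstance, fun L => ?_⟩
  have h1 := hμ.mean (L.comp (.inl ℝ E F))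
  have h2 := hν.mean (L.comp (.inr ℝ E F))
  have : ∀ x : E × F, L x = (L.comp (.inl ℝ E F)) x.1 + (L.comp (.inr ℝ E F)) x.2 := by
    intro x
    simp [← map_add]
  simp_rw [this]
  rw [integral_add, integral_fun_fst, integral_fun_snd, h1, h2]
  · simp
  · exact (IsGaussian.integrable_dual μ _).comp_fst _
  · exact (IsGaussian.integrable_dual ν _).comp_snd _

lemma IsCG.pi [CompleteSpace E] [SecondCountableTopology E] {μ : ι → Measure E}
    (hμ : ∀ i, IsCG (μ i)) : IsCG (Measure.pi μ) := by
  classical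
  have := fun i => (hμ i).gauss
  have hg : IsGaussian (Measure.pi μ) := by
    have := (iIndepFun_pi (μ := μ) (X := fun i (x : E) => x) (by fun_prop)).hasGaussianLaw
      (fun i => ⟨by
        rw [(measurePreserving_eval μ i).map_eq]; infer_instance⟩)
    simpa using this.isGaussian_map
  refine ⟨hg, fun L => ?_⟩
  have : ∀ x : ι → E, L x = ∑ i, (L.comp (.single ℝ (fun _ => E) i)) (x i) := by
    intro x
    conv_lhs => rw [← Finset.univ_sum_single x]
    simp
  simp_rw [this]
  rw [integral_finsetSum]
  · refine Finset.sum_eq_zero fun i _ => ?_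
    rw [← (hμ i).mean (L.comp (.single ℝ (fun _ => E) i)),
      ← (measurePreserving_eval μ i).map_eq,
      integral_map (measurePreserving_eval μ i).measurable.aemeasurable (by fun_prop)]
  · intro i _
    exact (measurePreserving_eval μ i).integrable_comp_of_integrable (IsGaussian.integrable_dual _ _)

lemma isCG_gaussianReal : IsCG (gaussianReal 0 1) := by
  refine ⟨inferInstance, fun L => ?_⟩
  have : ∀ x : ℝ, L x = x * L 1 := fun x => by
    conv_lhs => rw [← mul_one x, ← smul_eq_mul, map_smul, smul_eq_mul]
  generalize L 1 = c at this
  simp_rw [this, integral_mul_const]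
  simp

lemma isCG_stdG : IsCG (stdG ι) := IsCG.pi fun _ => isCG_gaussianReal

lemma isCG_dirac : IsCG (Measure.dirac (0 : E)) := ⟨inferInstance, fun L => by simp⟩

end closure

end

section
variable {ι : Type*} [Fintype ι] [DecidableEq ι]

lemma det_one_le_convex {W : Matrix ι ι ℝ} (hW : W.PosSemidef) (hdet : W.det = 1) {s r : ℝ}
    (hs : 0 ≤ s) (hr : 0 ≤ r) (hsr : s + r = 1) :
    1 ≤ (s • (1 : Matrix ι ι ℝ) + r • W).det := by
  set U : Matrix ι ι ℝ := (hW.1.eigenvectorUnitary : Matrix ι ι ℝ) with hU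
  set ev := hW.1.eigenvalues with hev
  have hUU : Uᵀ * U = 1 := by
    have := Unitary.coe_star_mul_self hW.1.eigenvectorUnitary
    simpa [star_eq_conjTranspose] using this
  have hUU' : U * Uᵀ = 1 := mul_eq_one_comm.1 hUU
  have hspec : W = U * diagonal ev * Uᵀ := by
    have := hW.1.spectral_theorem
    rw [Unitary.conjStarAlgAut_apply] at this
    simpa [star_eq_conjTranspose] using this
  have hev0 : ∀ i, 0 ≤ ev i := fun i => hW.eigenvalues_nonneg i
  have hprod : ∏ i, ev i = 1 := by
    rw [← hdet, hspec, det_mul_right_comm, hUU', Matrix.one_mul, det_diagonal]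
  have h1 : s • (1 : Matrix ι ι ℝ) + r • W = U * diagonal (fun i => s + r * ev i) * Uᵀ := by
    have : diagonal (fun i => s + r * ev i) = s • (1 : Matrix ι ι ℝ) + r • diagonal ev := by
      rw [smul_one_eq_diagonal, ← diagonal_smul, diagonal_add]
      rfl
    rw [this, Matrix.mul_add, Matrix.add_mul, Matrix.mul_smul, Matrix.smul_mul, Matrix.mul_one,
      hUU', Matrix.mul_smul, Matrix.smul_mul, ← hspec]
  rw [h1, det_mul_right_comm, hUU', Matrix.one_mul, det_diagonal]
  calc (1 : ℝ) = (∏ i, ev i) ^ r := by rw [hprod, Real.one_rpow]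
    _ = ∏ i, ev i ^ r := (Real.finsetProd_rpow _ _ (fun i _ => hev0 i) _).symm
    _ ≤ _ := by
      refine Finset.prod_le_prod (fun i _ => Real.rpow_nonneg (hev0 i) _) fun i _ => ?_
      have := Real.geom_mean_le_arith_mean2_weighted hs hr zero_le_one (hev0 i) hsr
      simpa using this

open scoped MatrixOrder in
lemma det_le_det_convex {X Y : Matrix ι ι ℝ} (hX : X.PosSemidef) (hY : Y.PosSemidef)
    (hdet : Y.det = X.det) {s r : ℝ} (hs : 0 ≤ s) (hr : 0 ≤ r) (hsr : s + r = 1) :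
    X.det ≤ (s • X + r • Y).det := by
  rcases hX.det_nonneg.eq_or_lt with h0 | hpos
  · rw [← h0]
    exact ((hX.smul hs).add (hY.smul hr)).det_nonneg
  obtain ⟨B, rfl⟩ := (CStarAlgebra.nonneg_iff_eq_star_mul_self (a := X)).1
    (Matrix.nonneg_iff_posSemidef.2 hX)
  have hB : IsUnit B.det := by
    rw [isUnit_iff_ne_zero]
    intro h
    simp [h] at hpos
  rw [star_eq_conjTranspose, conjTranspose_eq_transpose_of_trivial] at *
  have hBi : B⁻¹ * B = 1 := nonsing_inv_mul _ hB
  have hBt : Bᵀ * (B⁻¹)ᵀ = 1 := by rw [← transpose_mul, hBi, transpose_one]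
  set W : Matrix ι ι ℝ := (B⁻¹)ᵀ * Y * B⁻¹ with hW
  have hWp : W.PosSemidef := by simpa using hY.conjTranspose_mul_mul_same B⁻¹
  have hYW : Y = Bᵀ * W * B := by
    rw [hW, ← Matrix.mul_assoc, ← Matrix.mul_assoc, hBt, Matrix.one_mul, Matrix.mul_assoc, hBi,
      Matrix.mul_one]
  have hWd : W.det = 1 := by
    have h2 := hdet
    clear_value W
    rw [hYW, det_mul, det_mul, det_mul, det_transpose] at h2
    have := hB.ne_zero
    field_simp at h2
    exact h2
  have h3 : s • (Bᵀ * B) + r • Y = Bᵀ * (s • (1 : Matrix ι ι ℝ) + r • W) * B := by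
    rw [hYW, Matrix.mul_add, Matrix.add_mul]
    simp
  rw [h3, det_mul, det_mul, det_mul]
  have h4 := det_one_le_convex hWp hWd hs hr hsr
  have h5 : 0 ≤ Bᵀ.det * B.det := by
    rw [det_transpose]; exact mul_self_nonneg _
  nlinarith

/-- The principal minor of `C` with rows and columns in `S`. -/
def pminor (S : Finset ι) (C : Matrix ι ι ℝ) : ℝ :=
  (1 + diagonal (fun i => if i ∈ S then (1 : ℝ) else 0) * (C - 1)).det

lemma pminor_eq_det_posSemidef (S : Finset ι) (C : Matrix ι ι ℝ) :
    pminor S C = (diagonal (fun i => if i ∈ S then (0 : ℝ) else 1) +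
      diagonal (fun i => if i ∈ S then (1 : ℝ) else 0) * C *
        diagonal (fun i => if i ∈ S then (1 : ℝ) else 0)).det := by
  set P : Matrix ι ι ℝ := diagonal (fun i => if i ∈ S then (1 : ℝ) else 0) with hP
  have hPP : P * P = P := by
    rw [hP, diagonal_mul_diagonal]; congr; ext i; split_ifs <;> simp
  have hQ : diagonal (fun i => if i ∈ S then (0 : ℝ) else 1) = 1 - P := by
    rw [hP, ← diagonal_one, diagonal_sub]; congr; ext i; split_ifs <;> simp
  rw [pminor, ← hP, hQ]
  have : P * (C - 1) = P * (P * (C - 1)) := by rw [← Matrix.mul_assoc, hPP]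
  rw [this, det_one_add_mul_comm]
  congr 1
  rw [Matrix.mul_sub, Matrix.sub_mul, Matrix.mul_one, hPP]
  abel

lemma pminor_le_convex {X Y : Matrix ι ι ℝ} (hX : X.PosSemidef) (hY : Y.PosSemidef)
    (S : Finset ι) (hdet : pminor S Y = pminor S X) {s r : ℝ} (hs : 0 ≤ s) (hr : 0 ≤ r)
    (hsr : s + r = 1) : pminor S X ≤ pminor S (s • X + r • Y) := by
  simp only [pminor_eq_det_posSemidef] at *
  set P : Matrix ι ι ℝ := diagonal (fun i => if i ∈ S then (1 : ℝ) else 0) with hP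
  set Q : Matrix ι ι ℝ := diagonal (fun i => if i ∈ S then (0 : ℝ) else 1) with hQ
  have hQp : Q.PosSemidef := PosSemidef.diagonal fun i => by
    simp only [Pi.zero_apply]; split_ifs <;> simp
  have hp : ∀ Z : Matrix ι ι ℝ, Z.PosSemidef → (Q + P * Z * P).PosSemidef := fun Z hZ =>
    hQp.add (by simpa [hP] using hZ.mul_mul_conjTranspose_same P)
  have := det_le_det_convex (hp X hX) (hp Y hY) hdet hs hr hsr
  convert this using 2
  rw [smul_add, smul_add, Matrix.mul_add, Matrix.add_mul]
  have : Q = s • Q + r • Q := by rw [← add_smul, hsr, one_smul]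
  conv_lhs => rw [this]
  simp only [Matrix.mul_smul, Matrix.smul_mul]
  abel

lemma det_one_add_diagonal_mul (w : ι → ℝ) (C : Matrix ι ι ℝ) :
    (1 + diagonal w * C).det = ∑ S : Finset ι, (∏ i ∈ S, w i) * pminor S C := by
  have h1 : (1 + diagonal w * C).det =
      (detRowAlternating (R := ℝ) (n := ι)).toMultilinearMap
        ((fun i => w i • C i) + fun i => (1 : Matrix ι ι ℝ) i) := by
    change _ = Matrix.det _
    congr 1
    ext i j
    simp [add_comm, Matrix.one_apply]
  rw [h1, MultilinearMap.map_add_univ]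
  refine Finset.sum_congr rfl fun S _ => ?_
  have h2 : S.piecewise (fun i => w i • C i) (fun i => (1 : Matrix ι ι ℝ) i) =
      S.piecewise (fun i => w i • S.piecewise C (fun i => (1 : Matrix ι ι ℝ) i) i)
        (S.piecewise C fun i => (1 : Matrix ι ι ℝ) i) := by
    ext i j
    by_cases h : i ∈ S <;> simp [Finset.piecewise, h]
  rw [h2, MultilinearMap.map_piecewise_smul, smul_eq_mul, pminor]
  congr 1
  change Matrix.det _ = _
  congr 1
  ext i j
  by_cases h : i ∈ S <;> simp [Finset.piecewise, h, Matrix.one_apply]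

/-- The diagonal sign matrix attached to `T`. -/
def signMat (T : Finset ι) : Matrix ι ι ℝ := diagonal fun i => if i ∈ T then 1 else -1

lemma signMat_mul_self (T : Finset ι) : signMat T * signMat T = 1 := by
  rw [signMat, diagonal_mul_diagonal, ← diagonal_one]
  congr; ext i; split_ifs <;> simp

/-- The path from `C` (at `1`) to its block diagonal part (at `0`). -/
def royenPath (T : Finset ι) (C : Matrix ι ι ℝ) (τ : ℝ) : Matrix ι ι ℝ :=
  ((1 + τ) / 2) • C + ((1 - τ) / 2) • (signMat T * C * signMat T)

lemma royenPath_one (T : Finset ι) (C : Matrix ι ι ℝ) : royenPath T C 1 = C := by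
  simp [royenPath]

lemma PosSemidef.sign_conj {C : Matrix ι ι ℝ} (hC : C.PosSemidef) (T : Finset ι) :
    (signMat T * C * signMat T).PosSemidef := by
  simpa [signMat] using hC.mul_mul_conjTranspose_same (signMat T)

lemma posSemidef_royenPath {C : Matrix ι ι ℝ} (hC : C.PosSemidef) (T : Finset ι) {τ : ℝ}
    (h0 : 0 ≤ τ) (h1 : τ ≤ 1) : (royenPath T C τ).PosSemidef :=
  (hC.smul (by linarith)).add ((PosSemidef.sign_conj hC T).smul (by linarith))

lemma pminor_sign_conj (T S : Finset ι) (C : Matrix ι ι ℝ) :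
    pminor S (signMat T * C * signMat T) = pminor S C := by
  set P : Matrix ι ι ℝ := diagonal (fun i => if i ∈ S then (1 : ℝ) else 0) with hP
  have hcomm : P * signMat T = signMat T * P := by
    rw [hP, signMat, diagonal_mul_diagonal, diagonal_mul_diagonal]
    congr; ext i; ring
  have hJ := signMat_mul_self T
  have : 1 + P * (signMat T * C * signMat T - 1) = signMat T * (1 + P * (C - 1)) * signMat T := by
    simp only [Matrix.mul_add, Matrix.add_mul, Matrix.mul_sub, Matrix.sub_mul, Matrix.mul_one, hJ,
      ← Matrix.mul_assoc, hcomm]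
    rw [Matrix.mul_assoc (signMat T) P (signMat T), hcomm, ← Matrix.mul_assoc, hJ, Matrix.one_mul]
  rw [pminor, ← hP, this, det_mul_right_comm, hJ, Matrix.one_mul, pminor]

lemma antitoneOn_pminor_royenPath {C : Matrix ι ι ℝ} (hC : C.PosSemidef) (T S : Finset ι) :
    AntitoneOn (fun τ => pminor S (royenPath T C τ)) (Set.Icc 0 1) := by
  intro a ha b hb hab
  rcases hb.1.eq_or_lt with h0 | hpos
  · have : a = b := le_antisymm hab (h0 ▸ ha.1)
    rw [this]
  have hX := posSemidef_royenPath hC T hb.1 hb.2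
  have hY := PosSemidef.sign_conj hX T
  have hs : 0 ≤ (1 + a / b) / 2 := by have := div_nonneg ha.1 hb.1; linarith
  have hr : 0 ≤ (1 - a / b) / 2 := by have := (div_le_one hpos).2 hab; linarith
  have := pminor_le_convex hX hY S (pminor_sign_conj T S _) hs hr (by ring)
  refine this.trans (le_of_eq ?_)
  congr 1
  have hJ := signMat_mul_self T
  have h1 : signMat T * royenPath T C b * signMat T =
      ((1 + b) / 2) • (signMat T * C * signMat T) + ((1 - b) / 2) • C := by
    simp only [royenPath, Matrix.mul_add, Matrix.add_mul, Matrix.mul_smul, Matrix.smul_mul,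
      ← Matrix.mul_assoc, hJ, Matrix.one_mul]
    rw [Matrix.mul_assoc C, hJ, Matrix.mul_one]
  rw [h1, royenPath, royenPath, smul_add, smul_add, smul_smul, smul_smul, smul_smul, smul_smul]
  have e1 : (1 + a) / 2 = (1 + a / b) / 2 * ((1 + b) / 2) + (1 - a / b) / 2 * ((1 - b) / 2) := by
    field_simp; ring
  have e2 : (1 - a) / 2 = (1 + a / b) / 2 * ((1 - b) / 2) + (1 - a / b) / 2 * ((1 + b) / 2) := by
    field_simp; ring
  rw [e1, e2, add_smul, add_smul]
  abel

lemma differentiable_pminor_royenPath (C : Matrix ι ι ℝ) (T S : Finset ι) :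
    Differentiable ℝ (fun τ => pminor S (royenPath T C τ)) := by
  unfold pminor
  simp only [det_apply, royenPath, Matrix.add_apply, diagonal_mul, Matrix.sub_apply,
    Matrix.smul_apply, smul_eq_mul]
  fun_prop

lemma deriv_pminor_royenPath_nonpos {C : Matrix ι ι ℝ} (hC : C.PosSemidef) (T S : Finset ι)
    {τ : ℝ} (hτ : τ ∈ Set.Ioo (0 : ℝ) 1) :
    deriv (fun τ => pminor S (royenPath T C τ)) τ ≤ 0 := by
  rw [← derivWithin_of_isOpen isOpen_Ioo hτ]
  exact ((antitoneOn_pminor_royenPath hC T S).mono Set.Ioo_subset_Icc_self).derivWithin_nonpos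

end

section
variable {ι : Type*} [Fintype ι] [DecidableEq ι]

lemma integral_prod_powerSum {Ω : Type*} [MeasurableSpace Ω] {ν : Measure Ω}
    [IsProbabilityMeasure ν] {W : Ω → ι → ℝ} (hW : Measurable W)
    (h01 : ∀ ω i, W ω i ∈ Set.Icc (0 : ℝ) 1) (a : ι → ℕ → ℝ) (N : ℕ) :
    ∫ ω, ∏ i, ∑ n ∈ Finset.range N, a i n * W ω i ^ n ∂ν =
      ∑ k ∈ Fintype.piFinset (fun _ : ι => Finset.range N),
        (∏ i, a i (k i)) * ∫ ω, ∏ i, W ω i ^ k i ∂ν := by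
  simp_rw [Finset.prod_univ_sum, Finset.prod_mul_distrib]
  rw [integral_finsetSum]
  · simp_rw [integral_const_mul]
  · intro k _
    refine Integrable.const_mul ?_ _
    refine Integrable.of_bound (Measurable.aestronglyMeasurable (by fun_prop)) 1
      (Filter.Eventually.of_forall fun ω => ?_)
    rw [Real.norm_eq_abs, Finset.abs_prod]
    refine Finset.prod_le_one (fun i _ => abs_nonneg _) fun i _ => ?_
    rw [abs_of_nonneg (pow_nonneg (h01 ω i).1 _)]
    exact pow_le_one₀ (h01 ω i).1 (h01 ω i).2

lemma exp_neg_sq_mem (x : ℝ) : Real.exp (-x ^ 2 / 2) ∈ Set.Icc (0 : ℝ) 1 :=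
  ⟨(Real.exp_pos _).le, Real.exp_le_one_iff.2 (by nlinarith [sq_nonneg x])⟩

lemma HasGauss.integral_prod_exp_pow {μ : Measure (ι → ℝ)} {C : Matrix ι ι ℝ}
    (hμ : HasGauss μ C) (hC : C.PosSemidef) (k : ι → ℕ) :
    ∫ x, ∏ i, Real.exp (-x i ^ 2 / 2) ^ k i ∂μ =
      (√(1 + diagonal (fun i => (k i : ℝ)) * C).det)⁻¹ := by
  rw [← (hμ.integral_exp_neg_weighted hC (w := fun i => (k i : ℝ)) (fun i => by positivity)).2]
  congr with x
  simp_rw [← Real.exp_nat_mul]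
  rw [← Real.exp_sum, neg_div, Finset.sum_div, ← Finset.sum_neg_distrib]
  congr 1
  refine Finset.sum_congr rfl fun i _ => ?_
  ring

lemma HasGauss.integral_prod_powerSum {μ : Measure (ι → ℝ)} {C : Matrix ι ι ℝ}
    (hμ : HasGauss μ C) (hC : C.PosSemidef) (a : ι → ℕ → ℝ) (N : ℕ) :
    ∫ x, ∏ i, ∑ n ∈ Finset.range N, a i n * Real.exp (-x i ^ 2 / 2) ^ n ∂μ =
      ∑ k ∈ Fintype.piFinset (fun _ : ι => Finset.range N), (∏ i, a i (k i)) *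
        (√(1 + diagonal (fun i => (k i : ℝ)) * C).det)⁻¹ := by
  have := hμ.prob
  rw [_root_.integral_prod_powerSum (W := fun (x : ι → ℝ) i => Real.exp (-x i ^ 2 / 2))
    (by fun_prop) fun x i => exp_neg_sq_mem _]
  simp_rw [hμ.integral_prod_exp_pow hC]

lemma sum_prod_mul_det_pow_three_nonneg {C : Matrix ι ι ℝ} (hC : C.PosSemidef) {a : ι → ℕ → ℝ}
    {N : ℕ} (ha : ∀ i, ∀ u ∈ Set.Icc (0 : ℝ) 1, 0 ≤ ∑ n ∈ Finset.range N, a i n * u ^ n) :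
    0 ≤ ∑ k ∈ Fintype.piFinset (fun _ : ι => Finset.range N), (∏ i, a i (k i)) *
        (√(1 + diagonal (fun i => (k i : ℝ)) * C).det)⁻¹ ^ 3 := by
  obtain ⟨μ, hμ⟩ := exists_hasGauss hC
  have := hμ.prob
  have h01 : ∀ (x : Fin 3 → ι → ℝ) (i : ι),
      (∏ j, Real.exp (-x j i ^ 2 / 2)) ∈ Set.Icc (0 : ℝ) 1 := fun x i =>
    ⟨Finset.prod_nonneg fun j _ => (exp_neg_sq_mem _).1,
      Finset.prod_le_one (fun j _ => (exp_neg_sq_mem _).1) fun j _ => (exp_neg_sq_mem _).2⟩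
  have h := integral_prod_powerSum (ν := Measure.pi fun _ : Fin 3 => μ)
    (W := fun x i => ∏ j, Real.exp (-x j i ^ 2 / 2)) (by fun_prop) h01 a N
  have h2 : ∀ k : ι → ℕ, ∫ x : Fin 3 → ι → ℝ, ∏ i, (∏ j, Real.exp (-x j i ^ 2 / 2)) ^ k i
      ∂(Measure.pi fun _ : Fin 3 => μ) =
      (√(1 + diagonal (fun i => (k i : ℝ)) * C).det)⁻¹ ^ 3 := by
    intro k
    rw [← hμ.integral_prod_exp_pow hC]
    simp_rw [← Finset.prod_pow]
    have : ∀ x : Fin 3 → ι → ℝ, ∏ i, ∏ j, Real.exp (-x j i ^ 2 / 2) ^ k i =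
        ∏ j, ∏ i, Real.exp (-x j i ^ 2 / 2) ^ k i := fun x => Finset.prod_comm
    simp_rw [this]
    rw [integral_fintype_prod_eq_prod (fun (_ : Fin 3) (y : ι → ℝ) =>
      ∏ i, Real.exp (-y i ^ 2 / 2) ^ k i)]
    simp
  simp_rw [h2] at h
  rw [← h]
  exact integral_nonneg fun x => Finset.prod_nonneg fun i _ => ha i _ (h01 x i)

lemma monotoneOn_royen {C : Matrix ι ι ℝ} (hC : C.PosSemidef) (T : Finset ι)
    {a : ι → ℕ → ℝ} {N : ℕ}
    (ha : ∀ i, ∀ u ∈ Set.Icc (0 : ℝ) 1, 0 ≤ ∑ n ∈ Finset.range N, a i n * u ^ n)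
    (ha' : ∀ i, ∀ u ∈ Set.Icc (0 : ℝ) 1, 0 ≤ ∑ n ∈ Finset.range N, (n * a i n) * u ^ n) :
    MonotoneOn (fun τ => ∑ k ∈ Fintype.piFinset (fun _ : ι => Finset.range N),
      (∏ i, a i (k i)) *
        (√(1 + diagonal (fun i => (k i : ℝ)) * royenPath T C τ).det)⁻¹) (Set.Icc 0 1) := by
  set p : Finset ι → ℝ → ℝ := fun S τ => pminor S (royenPath T C τ) with hp
  set D : (ι → ℕ) → ℝ → ℝ := fun k τ => (1 + diagonal (fun i => (k i : ℝ)) * royenPath T C τ).det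
    with hD
  have hDpos : ∀ k, ∀ τ ∈ Set.Icc (0 : ℝ) 1, 0 < D k τ := by
    intro k τ hτ
    have hP := posSemidef_royenPath hC T hτ.1 hτ.2
    obtain ⟨μ, hμ⟩ := exists_hasGauss hP
    exact (hμ.integral_exp_neg_weighted hP (fun i => by positivity)).1
  have hDeq : ∀ k, D k = fun τ => ∑ S : Finset ι, (∏ i ∈ S, (k i : ℝ)) * p S τ := by
    intro k; ext τ
    exact det_one_add_diagonal_mul _ _
  have hDd : ∀ k τ, HasDerivAt (D k) (∑ S : Finset ι, (∏ i ∈ S, (k i : ℝ)) * deriv (p S) τ) τ := by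
    intro k τ
    rw [hDeq]
    exact HasDerivAt.fun_sum fun S _ =>
      ((differentiable_pminor_royenPath C T S τ).hasDerivAt).const_mul _
  have hder : ∀ τ ∈ Set.Icc (0 : ℝ) 1, HasDerivAt
      (fun τ => ∑ k ∈ Fintype.piFinset (fun _ : ι => Finset.range N),
        (∏ i, a i (k i)) * (√(D k τ))⁻¹)
      (∑ k ∈ Fintype.piFinset (fun _ : ι => Finset.range N), (∏ i, a i (k i)) *
        (-(1 / 2) * (∑ S : Finset ι, (∏ i ∈ S, (k i : ℝ)) * deriv (p S) τ) *
          (√(D k τ))⁻¹ ^ 3)) τ := by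
    intro τ hτ
    refine HasDerivAt.fun_sum fun k _ => HasDerivAt.const_mul _ ?_
    have h0 := hDpos k τ hτ
    have hs := Real.sqrt_pos.2 h0
    convert ((hDd k τ).sqrt h0.ne').fun_inv hs.ne' using 1
    field_simp
  refine monotoneOn_of_deriv_nonneg (convex_Icc 0 1)
    (fun τ hτ => (hder τ hτ).continuousAt.continuousWithinAt)
    (fun τ hτ => (hder τ (interior_subset hτ)).differentiableAt.differentiableWithinAt)
    fun τ hτ => ?_
  rw [(hder τ (interior_subset hτ)).deriv]
  rw [interior_Icc] at hτ
  have key : ∀ S : Finset ι, 0 ≤ ∑ k ∈ Fintype.piFinset (fun _ : ι => Finset.range N),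
      (∏ i, a i (k i)) * (∏ i ∈ S, (k i : ℝ)) * (√(D k τ))⁻¹ ^ 3 := by
    intro S
    have h := sum_prod_mul_det_pow_three_nonneg
      (posSemidef_royenPath hC T hτ.1.le hτ.2.le)
      (a := fun i n => if i ∈ S then n * a i n else a i n) (N := N) (fun i u hu => by
        by_cases h : i ∈ S <;> simp only [h, if_true, if_false]
        · exact ha' i u hu
        · exact ha i u hu)
    refine h.trans_eq (Finset.sum_congr rfl fun k _ => ?_)
    congr 1
    rw [← Fintype.prod_ite_mem S, ← Finset.prod_mul_distrib]
    refine Finset.prod_congr rfl fun i _ => ?_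
    split_ifs <;> ring
  have : (∑ k ∈ Fintype.piFinset (fun _ : ι => Finset.range N), (∏ i, a i (k i)) *
        (-(1 / 2) * (∑ S : Finset ι, (∏ i ∈ S, (k i : ℝ)) * deriv (p S) τ) *
          (√(D k τ))⁻¹ ^ 3)) =
      ∑ S : Finset ι, (-(1 / 2) * deriv (p S) τ) *
        ∑ k ∈ Fintype.piFinset (fun _ : ι => Finset.range N),
          (∏ i, a i (k i)) * (∏ i ∈ S, (k i : ℝ)) * (√(D k τ))⁻¹ ^ 3 := by
    simp_rw [Finset.mul_sum, Finset.sum_mul, Finset.mul_sum]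
    rw [Finset.sum_comm]
    refine Finset.sum_congr rfl fun S _ => Finset.sum_congr rfl fun k _ => ?_
    ring
  rw [this]
  refine Finset.sum_nonneg fun S _ => mul_nonneg ?_ (key S)
  have := deriv_pminor_royenPath_nonpos hC T S hτ
  simp only [hp]
  linarith

lemma HasGauss.split {μ : Measure (ι → ℝ)} {C : Matrix ι ι ℝ} (hμ : HasGauss μ C)
    (T : Finset ι) :
    HasGauss ((μ.prod μ).map fun z i => if i ∈ T then z.1 i else z.2 i) (royenPath T C 0) := by
  have := hμ.prob
  have hm : Measurable (fun (z : (ι → ℝ) × (ι → ℝ)) i => if i ∈ T then z.1 i else z.2 i) := by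
    refine measurable_pi_lambda _ fun i => ?_
    split_ifs <;> fun_prop
  refine ⟨Measure.isProbabilityMeasure_map hm.aemeasurable, fun t => ?_⟩
  rw [integral_map hm.aemeasurable (by fun_prop)]
  set u : ι → ℝ := (1 / 2 : ℝ) • (t + signMat T *ᵥ t) with hu
  set v : ι → ℝ := (1 / 2 : ℝ) • (t - signMat T *ᵥ t) with hv
  have huv : ∀ z : (ι → ℝ) × (ι → ℝ), t ⬝ᵥ (fun i => if i ∈ T then z.1 i else z.2 i) =
      u ⬝ᵥ z.1 + v ⬝ᵥ z.2 := by
    intro z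
    simp only [dotProduct, ← Finset.sum_add_distrib]
    refine Finset.sum_congr rfl fun i _ => ?_
    simp only [hu, hv, signMat, Pi.smul_apply, Pi.add_apply, Pi.sub_apply, mulVec_diagonal,
      smul_eq_mul]
    split_ifs <;> ring
  simp_rw [huv]
  push_cast
  simp_rw [add_mul, Complex.exp_add]
  rw [integral_prod_mul (fun x => Complex.exp ((u ⬝ᵥ x : ℝ) * Complex.I))
    (fun x => Complex.exp ((v ⬝ᵥ x : ℝ) * Complex.I)), hμ.charFun_eq, hμ.charFun_eq,
    ← Complex.exp_add]
  congr 1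
  rw [← Complex.ofReal_add, ← Complex.ofReal_neg, ← Complex.ofReal_ofNat, ← Complex.ofReal_div]
  congr 1
  have hsym : ∀ y : ι → ℝ, (signMat T *ᵥ t) ⬝ᵥ y = t ⬝ᵥ (signMat T *ᵥ y) := by
    intro y
    rw [dotProduct_mulVec, ← mulVec_transpose]
    simp [signMat]
  rw [hu, hv, royenPath]
  simp only [mulVec_smul, mulVec_add, mulVec_sub, add_mulVec, smul_mulVec, dotProduct_smul,
    smul_dotProduct, add_dotProduct, sub_dotProduct, dotProduct_add, dotProduct_sub, smul_eq_mul,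
    hsym, mulVec_mulVec, ← Matrix.mul_assoc]
  ring

lemma HasGauss.integral_prod_powerSum_mul_le {μ : Measure (ι → ℝ)} {C : Matrix ι ι ℝ}
    (hμ : HasGauss μ C) (hC : C.PosSemidef) (T : Finset ι) {a : ι → ℕ → ℝ} {N : ℕ}
    (ha : ∀ i, ∀ u ∈ Set.Icc (0 : ℝ) 1, 0 ≤ ∑ n ∈ Finset.range N, a i n * u ^ n)
    (ha' : ∀ i, ∀ u ∈ Set.Icc (0 : ℝ) 1, 0 ≤ ∑ n ∈ Finset.range N, (n * a i n) * u ^ n) :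
    (∫ x, ∏ i ∈ T, ∑ n ∈ Finset.range N, a i n * Real.exp (-x i ^ 2 / 2) ^ n ∂μ) *
      (∫ x, ∏ i ∈ Tᶜ, ∑ n ∈ Finset.range N, a i n * Real.exp (-x i ^ 2 / 2) ^ n ∂μ) ≤
    ∫ x, ∏ i, ∑ n ∈ Finset.range N, a i n * Real.exp (-x i ^ 2 / 2) ^ n ∂μ := by
  have := hμ.prob
  have h := monotoneOn_royen hC T ha ha' (Set.left_mem_Icc.2 zero_le_one)
    (Set.right_mem_Icc.2 zero_le_one) zero_le_one
  simp only [royenPath_one] at h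
  rw [← hμ.integral_prod_powerSum hC, ← (hμ.split T).integral_prod_powerSum
    (posSemidef_royenPath hC T le_rfl zero_le_one)] at h
  refine le_trans (le_of_eq ?_) h
  have hm : Measurable (fun (z : (ι → ℝ) × (ι → ℝ)) i => if i ∈ T then z.1 i else z.2 i) := by
    refine measurable_pi_lambda _ fun i => ?_
    split_ifs <;> fun_prop
  rw [integral_map hm.aemeasurable (Measurable.aestronglyMeasurable (by fun_prop)),
    ← integral_prod_mul]
  congr with z
  rw [← Finset.prod_mul_prod_compl T]
  congr 1
  · refine Finset.prod_congr rfl fun i hi => ?_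
    simp [hi]
  · refine Finset.prod_congr rfl fun i hi => ?_
    simp [Finset.mem_compl.1 hi]

end

section slabPoly
open Polynomial Filter Topology

/-- Polynomials increasing on `[0, 1]` that approximate the indicator function of `[x₀, 1]`. -/
def slabPoly (x₀ : ℝ) (m : ℕ) : ℝ[X] :=
  1 - (1 - X ^ (m + 1)) ^ ⌈((m : ℝ) + 1) * x₀⁻¹ ^ (m + 1)⌉₊

lemma eval_slabPoly (x₀ : ℝ) (m : ℕ) (u : ℝ) : (slabPoly x₀ m).eval u =
    1 - (1 - u ^ (m + 1)) ^ ⌈((m : ℝ) + 1) * x₀⁻¹ ^ (m + 1)⌉₊ := by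
  simp [slabPoly]

lemma eval_slabPoly_mem (x₀ : ℝ) (m : ℕ) {u : ℝ} (hu : u ∈ Set.Icc (0 : ℝ) 1) :
    (slabPoly x₀ m).eval u ∈ Set.Icc (0 : ℝ) 1 := by
  rw [eval_slabPoly]
  have h1 : 0 ≤ 1 - u ^ (m + 1) := sub_nonneg.2 (pow_le_one₀ hu.1 hu.2)
  have h2 : 1 - u ^ (m + 1) ≤ 1 := sub_le_self _ (pow_nonneg hu.1 _)
  exact ⟨sub_nonneg.2 (pow_le_one₀ h1 h2), sub_le_self _ (pow_nonneg h1 _)⟩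

lemma eval_X_mul_derivative_slabPoly_nonneg (x₀ : ℝ) (m : ℕ) {u : ℝ}
    (hu : u ∈ Set.Icc (0 : ℝ) 1) : 0 ≤ (X * derivative (slabPoly x₀ m)).eval u := by
  have h1 : 0 ≤ 1 - u ^ (m + 1) := sub_nonneg.2 (pow_le_one₀ hu.1 hu.2)
  have h0 := hu.1
  simp only [slabPoly, derivative_sub, derivative_one, derivative_pow, derivative_X, eval_mul,
    eval_X, eval_sub, eval_pow, eval_one, eval_C, eval_neg, zero_sub, mul_one]
  have : 0 ≤ (⌈((m : ℝ) + 1) * x₀⁻¹ ^ (m + 1)⌉₊ : ℝ) *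
    (1 - u ^ (m + 1)) ^ (⌈((m : ℝ) + 1) * x₀⁻¹ ^ (m + 1)⌉₊ - 1) *
      (((m + 1 : ℕ) : ℝ) * u ^ (m + 1 - 1)) := by positivity
  nlinarith

lemma tendsto_eval_slabPoly {x₀ : ℝ} (h0 : 0 < x₀) (hx1 : x₀ ≤ 1) {u : ℝ}
    (hu : u ∈ Set.Icc (0 : ℝ) 1) :
    Tendsto (fun m => (slabPoly x₀ m).eval u) atTop (𝓝 (if x₀ ≤ u then 1 else 0)) := by
  simp only [eval_slabPoly]
  have hu0 := hu.1
  split_ifs with h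
  · rw [show 𝓝 (1 : ℝ) = 𝓝 (1 - 0) by simp]
    refine Tendsto.sub tendsto_const_nhds ?_
    have hlim : Tendsto (fun m : ℕ => Real.exp (-((m : ℝ) + 1))) atTop (𝓝 0) :=
      Real.tendsto_exp_neg_atTop_nhds_zero.comp
        (tendsto_atTop_add_const_right _ _ tendsto_natCast_atTop_atTop)
    refine squeeze_zero (fun m => pow_nonneg (sub_nonneg.2 (pow_le_one₀ hu.1 hu.2)) _)
      (fun m => ?_) hlim
    have hb := Nat.le_ceil (((m : ℝ) + 1) * x₀⁻¹ ^ (m + 1))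
    set b := ⌈((m : ℝ) + 1) * x₀⁻¹ ^ (m + 1)⌉₊
    calc (1 - u ^ (m + 1)) ^ b ≤ (Real.exp (-u ^ (m + 1))) ^ b := by
          refine pow_le_pow_left₀ (sub_nonneg.2 (pow_le_one₀ hu.1 hu.2)) ?_ _
          have := Real.add_one_le_exp (-u ^ (m + 1))
          linarith
      _ = Real.exp (-(b * u ^ (m + 1))) := by rw [← Real.exp_nat_mul]; ring_nf
      _ ≤ _ := by
          refine Real.exp_le_exp.2 (neg_le_neg ?_)
          have h2 : 1 ≤ x₀⁻¹ ^ (m + 1) * u ^ (m + 1) := by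
            rw [← mul_pow]
            refine one_le_pow₀ ?_
            rw [inv_mul_eq_div]
            exact (one_le_div h0).2 h
          have h3 : 0 ≤ u ^ (m + 1) := by positivity
          have h4 : (0 : ℝ) ≤ (m : ℝ) + 1 := by positivity
          nlinarith [mul_le_mul_of_nonneg_right hb h3]
  · push Not at h
    set r := x₀⁻¹ * u with hr
    have hr0 : 0 ≤ r := by positivity
    have hr1 : r < 1 := by rw [hr, inv_mul_eq_div]; exact (div_lt_one h0).2 h
    have hlim : Tendsto (fun m : ℕ => ((m + 1 : ℕ) : ℝ) * r ^ (m + 1) + r ^ (m + 1) * x₀ ^ (m + 1))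
        atTop (𝓝 0) := by
      have h1 := (tendsto_add_atTop_iff_nat 1).2 (tendsto_self_mul_const_pow_of_lt_one hr0 hr1)
      have h2 : Tendsto (fun m : ℕ => r ^ (m + 1) * x₀ ^ (m + 1)) atTop (𝓝 0) := by
        simp_rw [← mul_pow]
        refine (tendsto_add_atTop_iff_nat 1).2 (tendsto_pow_atTop_nhds_zero_of_lt_one
          (by positivity) ?_)
        rw [hr]
        field_simp
        exact h.trans_le hx1
      simpa using h1.add h2
    refine squeeze_zero (fun m => ?_) (fun m => ?_) hlim
    · have h1 : 0 ≤ 1 - u ^ (m + 1) := sub_nonneg.2 (pow_le_one₀ hu.1 hu.2)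
      have h2 : 1 - u ^ (m + 1) ≤ 1 := sub_le_self _ (pow_nonneg hu.1 _)
      exact sub_nonneg.2 (pow_le_one₀ h1 h2)
    have hb := (Nat.ceil_lt_add_one (a := ((m : ℝ) + 1) * x₀⁻¹ ^ (m + 1)) (by positivity)).le
    set b := ⌈((m : ℝ) + 1) * x₀⁻¹ ^ (m + 1)⌉₊
    have hB := one_add_mul_le_pow (a := -u ^ (m + 1))
      (by have := pow_le_one₀ hu.1 hu.2 (n := m + 1); linarith) b
    have h3 : 0 ≤ u ^ (m + 1) := by positivity
    have h5 := mul_le_mul_of_nonneg_right hb h3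
    have h6 : r ^ (m + 1) = x₀⁻¹ ^ (m + 1) * u ^ (m + 1) := mul_pow _ _ _
    have h7 : r ^ (m + 1) * x₀ ^ (m + 1) = u ^ (m + 1) := by
      rw [← mul_pow, hr]; congr 1; field_simp
    rw [h7, h6]
    push_cast
    rw [← sub_eq_add_neg] at hB
    linarith

end slabPoly

section
open Filter Topology
variable {ι : Type*} [Fintype ι] [DecidableEq ι]

lemma coeff_X_mul_derivative (p : Polynomial ℝ) (n : ℕ) :
    (Polynomial.X * Polynomial.derivative p).coeff n = n * p.coeff n := by
  cases n with
  | zero => simp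
  | succ n => rw [Polynomial.coeff_X_mul, Polynomial.coeff_derivative]; push_cast; ring

lemma HasGauss.integral_prod_eval_mul_le {μ : Measure (ι → ℝ)} {C : Matrix ι ι ℝ}
    (hμ : HasGauss μ C) (hC : C.PosSemidef) (T : Finset ι) {Q : ι → Polynomial ℝ}
    (hQ : ∀ i, ∀ u ∈ Set.Icc (0 : ℝ) 1, 0 ≤ (Q i).eval u)
    (hQ' : ∀ i, ∀ u ∈ Set.Icc (0 : ℝ) 1, 0 ≤ (Polynomial.X * (Q i).derivative).eval u) :
    (∫ x, ∏ i ∈ T, (Q i).eval (Real.exp (-x i ^ 2 / 2)) ∂μ) *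
      (∫ x, ∏ i ∈ Tᶜ, (Q i).eval (Real.exp (-x i ^ 2 / 2)) ∂μ) ≤
    ∫ x, ∏ i, (Q i).eval (Real.exp (-x i ^ 2 / 2)) ∂μ := by
  set N : ℕ := ∑ i, ((Q i).natDegree + (Polynomial.X * (Q i).derivative).natDegree) + 1 with hN
  have hle : ∀ i, (Q i).natDegree + (Polynomial.X * (Q i).derivative).natDegree < N := fun i =>
    Nat.lt_succ_of_le (Finset.single_le_sum
      (f := fun i => (Q i).natDegree + (Polynomial.X * (Q i).derivative).natDegree)
      (fun _ _ => Nat.zero_le _) (Finset.mem_univ i))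
  have e1 : ∀ i u, (Q i).eval u = ∑ n ∈ Finset.range N, (Q i).coeff n * u ^ n := fun i u =>
    Polynomial.eval_eq_sum_range' (by have := hle i; omega) u
  have e2 : ∀ i u, (Polynomial.X * (Q i).derivative).eval u =
      ∑ n ∈ Finset.range N, (n * (Q i).coeff n) * u ^ n := fun i u => by
    rw [Polynomial.eval_eq_sum_range' (n := N) (by have := hle i; omega) u]
    simp_rw [coeff_X_mul_derivative]
  simp only [e1]
  refine hμ.integral_prod_powerSum_mul_le hC T (fun i u hu => ?_) fun i u hu => ?_
  · rw [← e1]; exact hQ i u hu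
  · rw [← e2]; exact hQ' i u hu

/-- **Gaussian correlation inequality** for two families of symmetric slabs. -/
theorem HasGauss.slab_mul_le {μ : Measure (ι → ℝ)} {C : Matrix ι ι ℝ} (hμ : HasGauss μ C)
    (hC : C.PosSemidef) {T₁ T₂ : Finset ι} (hT : Disjoint T₁ T₂) (s : ι → ℝ) :
    μ.real {x | ∀ i ∈ T₁, |x i| ≤ s i} * μ.real {x | ∀ i ∈ T₂, |x i| ≤ s i} ≤
      μ.real {x | ∀ i ∈ T₁ ∪ T₂, |x i| ≤ s i} := by
  have := hμ.prob
  by_cases hs : ∃ i ∈ T₁ ∪ T₂, s i < 0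
  · obtain ⟨i, hi, hsi⟩ := hs
    have hemp : ∀ T : Finset ι, i ∈ T → {x : ι → ℝ | ∀ i ∈ T, |x i| ≤ s i} = ∅ := by
      intro T hiT
      ext x
      simp only [Set.mem_ofPred_eq, Set.mem_empty_iff_false, iff_false]
      intro h
      exact absurd ((abs_nonneg _).trans (h i hiT)) (not_le.2 hsi)
    rcases Finset.mem_union.1 hi with h | h
    · simp [hemp _ h]
    · simp [hemp _ h]
  push Not at hs
  set x₀ : ι → ℝ := fun i => Real.exp (-s i ^ 2 / 2) with hx₀
  set Q : ι → ℕ → Polynomial ℝ := fun i m => if i ∈ T₁ ∪ T₂ then slabPoly (x₀ i) m else 1 with hQ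
  set g : (ι → ℝ) → ι → ℝ := fun x i => if i ∈ T₁ ∪ T₂ → |x i| ≤ s i then 1 else 0 with hg
  have hQ01 : ∀ i m, ∀ u ∈ Set.Icc (0 : ℝ) 1, (Q i m).eval u ∈ Set.Icc (0 : ℝ) 1 := by
    intro i m u hu
    by_cases h : i ∈ T₁ ∪ T₂ <;> simp only [hQ, h, if_true, if_false]
    · exact eval_slabPoly_mem _ _ hu
    · simp
  have hQ' : ∀ i m, ∀ u ∈ Set.Icc (0 : ℝ) 1, 0 ≤ (Polynomial.X * (Q i m).derivative).eval u := by
    intro i m u hu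
    by_cases h : i ∈ T₁ ∪ T₂ <;> simp only [hQ, h, if_true, if_false]
    · exact eval_X_mul_derivative_slabPoly_nonneg _ _ hu
    · simp
  have hlim : ∀ x i, Tendsto (fun m => (Q i m).eval (Real.exp (-x i ^ 2 / 2))) atTop
      (𝓝 (g x i)) := by
    intro x i
    by_cases h : i ∈ T₁ ∪ T₂
    · have := tendsto_eval_slabPoly (x₀ := x₀ i) (Real.exp_pos _)
        (exp_neg_sq_mem (s i)).2 (exp_neg_sq_mem (x i))
      simp only [hQ, hg, h, if_true, forall_const]
      convert this using 3
      simp only [hx₀, Real.exp_le_exp]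
      rw [← sq_le_sq₀ (abs_nonneg _) (hs i h), sq_abs]
      constructor <;> intro <;> linarith
    · simp only [hQ, hg, h, if_false, false_imp_iff, if_true]
      simp
  have hint : ∀ T : Finset ι, Tendsto
      (fun m => ∫ x, ∏ i ∈ T, (Q i m).eval (Real.exp (-x i ^ 2 / 2)) ∂μ) atTop
      (𝓝 (μ.real {x | ∀ i ∈ T, i ∈ T₁ ∪ T₂ → |x i| ≤ s i})) := by
    intro T
    have hms : MeasurableSet {x : ι → ℝ | ∀ i ∈ T, i ∈ T₁ ∪ T₂ → |x i| ≤ s i} := by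
      refine IsClosed.measurableSet ?_
      simp only [Set.ofPred_forall]
      refine isClosed_iInter fun i => isClosed_iInter fun _ => isClosed_iInter fun _ => ?_
      exact isClosed_le (by fun_prop) (by fun_prop)
    rw [← integral_indicator_one hms]
    refine tendsto_integral_of_dominated_convergence (fun _ => 1) (fun m => ?_)
      (integrable_const _) (fun m => Eventually.of_forall fun x => ?_)
      (Eventually.of_forall fun x => ?_)
    · exact Measurable.aestronglyMeasurable (Finset.measurable_fun_prod _ fun i _ =>
        (Q i m).continuous.measurable.comp (by fun_prop))
    · rw [Real.norm_eq_abs, Finset.abs_prod]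
      refine Finset.prod_le_one (fun i _ => abs_nonneg _) fun i _ => ?_
      rw [abs_of_nonneg (hQ01 i m _ (exp_neg_sq_mem _)).1]
      exact (hQ01 i m _ (exp_neg_sq_mem _)).2
    · convert tendsto_finsetProd T fun i _ => hlim x i using 2
      simp only [hg, Set.indicator_apply, Set.mem_ofPred_eq, Pi.one_apply]
      rw [Finset.prod_ite_zero]
      simp
  have key : ∀ m, _ := fun m => hμ.integral_prod_eval_mul_le hC T₁ (Q := fun i => Q i m)
    (fun i u hu => (hQ01 i m u hu).1) fun i u hu => hQ' i m u hu
  have := le_of_tendsto_of_tendsto' ((hint T₁).mul (hint T₁ᶜ)) (hint Finset.univ) key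
  have e1 : {x : ι → ℝ | ∀ i ∈ T₁, |x i| ≤ s i} =
      {x | ∀ i ∈ T₁, i ∈ T₁ ∪ T₂ → |x i| ≤ s i} := by
    ext x
    exact forall₂_congr fun i hi => by simp [hi]
  have e2 : {x : ι → ℝ | ∀ i ∈ T₂, |x i| ≤ s i} =
      {x | ∀ i ∈ T₁ᶜ, i ∈ T₁ ∪ T₂ → |x i| ≤ s i} := by
    ext x
    simp only [Set.mem_ofPred_eq]
    refine forall_congr' fun i => ?_
    have : i ∈ T₂ → i ∉ T₁ := fun h h' => Finset.disjoint_left.1 hT h' h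
    simp only [Finset.mem_compl, Finset.mem_union]
    tauto
  have e3 : {x : ι → ℝ | ∀ i ∈ T₁ ∪ T₂, |x i| ≤ s i} =
      {x | ∀ i ∈ Finset.univ, i ∈ T₁ ∪ T₂ → |x i| ≤ s i} := by
    ext x
    simp
  rw [e1, e2, e3]
  exact this

/-- **Gaussian correlation inequality** for a partition into blocks of symmetric slabs. -/
theorem HasGauss.prod_slab_le {A : Type*} [Fintype A] [DecidableEq A] {μ : Measure (ι → ℝ)}
    {C : Matrix ι ι ℝ} (hμ : HasGauss μ C) (hC : C.PosSemidef) (b : ι → A) (s : ι → ℝ) :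
    ∏ a, μ.real {x | ∀ i, b i = a → |x i| ≤ s i} ≤ μ.real {x | ∀ i, |x i| ≤ s i} := by
  have := hμ.prob
  have key : ∀ R : Finset A, ∏ a ∈ R, μ.real {x | ∀ i, b i = a → |x i| ≤ s i} ≤
      μ.real {x | ∀ i ∈ Finset.univ.filter (fun i => b i ∈ R), |x i| ≤ s i} := by
    intro R
    induction R using Finset.induction_on with
    | empty => simp
    | insert a R ha ih =>
      rw [Finset.prod_insert ha]
      have h := hμ.slab_mul_le hC (T₁ := Finset.univ.filter (fun i => b i = a))
        (T₂ := Finset.univ.filter (fun i => b i ∈ R)) (by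
          rw [Finset.disjoint_filter]; rintro i _ rfl; exact ha) s
      calc _ ≤ μ.real {x | ∀ i, b i = a → |x i| ≤ s i} *
            μ.real {x | ∀ i ∈ Finset.univ.filter (fun i => b i ∈ R), |x i| ≤ s i} :=
            mul_le_mul_of_nonneg_left ih measureReal_nonneg
        _ ≤ _ := by
            have e1 : {x : ι → ℝ | ∀ i, b i = a → |x i| ≤ s i} =
                {x | ∀ i ∈ Finset.univ.filter (fun i => b i = a), |x i| ≤ s i} := by
              ext x; simp
            rw [e1]
            refine h.trans_eq ?_
            congr 1
            ext x
            simp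
  refine (key Finset.univ).trans_eq ?_
  congr 1
  ext x
  simp

end

section
open scoped ENNReal

lemma lintegral_pi_prod {ι : Type*} [Fintype ι] {X : ι → Type*} [∀ i, MeasurableSpace (X i)]
    {μ : ∀ i, Measure (X i)} [∀ i, IsProbabilityMeasure (μ i)] {f : ∀ i, X i → ℝ≥0∞}
    (hf : ∀ i, Measurable (f i)) :
    ∫⁻ x, ∏ i, f i (x i) ∂Measure.pi μ = ∏ i, ∫⁻ x, f i x ∂μ i := by
  have h := iIndepFun_pi (μ := μ) (X := f) fun i => (hf i).aemeasurable
  rw [lintegral_prod_eq_prod_lintegral_of_indepFun Finset.univ _ h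
    fun i => (hf i).comp (measurable_pi_apply i)]
  refine Finset.prod_congr rfl fun i _ => ?_
  exact (measurePreserving_eval μ i).lintegral_comp (hf i)

section rotation
variable {E : Type*} [NormedAddCommGroup E] [NormedSpace ℝ E] [MeasurableSpace E] [BorelSpace E]
  [SecondCountableTopology E] [CompleteSpace E]

lemma IsCG.map_rotation {μ : Measure E} (hμ : IsCG μ) (θ : ℝ) :
    (μ.prod μ).map (ContinuousLinearMap.rotation θ) = μ.prod μ :=
  have := hμ.gauss
  IsGaussian.map_rotation_eq_self_of_forall_strongDual_eq_zero hμ.mean θ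

lemma IsCG.lintegral_rotate {μ : Measure E} (hμ : IsCG μ) {f : E × E → ℝ≥0∞}
    (hf : Measurable f) :
    ∫⁻ p, f p ∂(μ.prod μ) =
      ∫⁻ p, f ((√2)⁻¹ • (p.1 + p.2), (√2)⁻¹ • (p.1 - p.2)) ∂(μ.prod μ) := by
  have := hμ.gauss
  rw [← lintegral_prod_swap]
  conv_lhs => rw [← hμ.map_rotation (-(Real.pi / 4))]
  refine (lintegral_map (f := fun z : E × E => f z.swap) (hf.comp measurable_swap)
    (ContinuousLinearMap.measurable _)).trans ?_
  refine lintegral_congr fun p => ?_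
  have : √2 / 2 = (√2)⁻¹ := by
    rw [div_eq_iff two_ne_zero, ← div_eq_inv_mul, eq_div_iff (by positivity)]
    exact Real.mul_self_sqrt zero_le_two
  simp only [ContinuousLinearMap.rotation_apply, Prod.swap, Real.cos_neg, Real.sin_neg,
    Real.cos_pi_div_four, Real.sin_pi_div_four, this, neg_neg, smul_add, smul_neg, neg_smul,
    sub_eq_add_neg]

end rotation

/-- Gaussian correlation inequality for a law on `A × J → ℝ`, in `ℝ≥0∞`. -/
lemma IsCG.prod_slab_le {A J : Type*} [Fintype A] [Fintype J] {ρ : Measure (A × J → ℝ)}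
    (hρ : IsCG ρ) (s : A → J → ℝ) :
    ∏ a, ρ {x | ∀ j, |x (a, j)| ≤ s a j} ≤ ρ {x | ∀ a j, |x (a, j)| ≤ s a j} := by
  classical
  have := hρ.gauss
  obtain ⟨C, hC, h⟩ := hρ.exists_hasGauss
  have key := h.prod_slab_le hC Prod.fst fun i => s i.1 i.2
  have e : ∀ a, {x : A × J → ℝ | ∀ i : A × J, i.1 = a → |x i| ≤ s i.1 i.2} =
      {x | ∀ j, |x (a, j)| ≤ s a j} := by
    intro a
    ext x
    simp only [Set.mem_ofPred_eq, Prod.forall]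
    exact ⟨fun h j => h a j rfl, fun h a' j e => by subst e; exact h j⟩
  simp_rw [e, Prod.forall, measureReal_def, ← ENNReal.toReal_prod] at key
  exact (ENNReal.toReal_le_toReal (ENNReal.prod_ne_top fun a _ => measure_ne_top _ _)
    (measure_ne_top _ _)).1 key

variable {n : Type*} [Fintype n]

/-- Functions of the form `y ↦ P(α y + W ≤ c)` with `W` a centered Gaussian vector. -/
def PolyMix (F : (n → ℝ) → ℝ≥0∞) : Prop :=
  ∃ (J : Type) (_ : Fintype J) (α : Matrix J n ℝ) (κ : Measure (J → ℝ)) (_ : IsCG κ) (c : J → ℝ),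
    ∀ y, F y = κ {w | ∀ j, (α *ᵥ y) j + w j ≤ c j}

/-- The Gaussian doubling operator. -/
def doubling (F : (n → ℝ) → ℝ≥0∞) (u : n → ℝ) : ℝ≥0∞ :=
  ∫⁻ v, F ((√2)⁻¹ • (u + v)) * F ((√2)⁻¹ • (u - v)) ∂stdG n

lemma measurableSet_forall_le {J X : Type*} [Fintype J] [MeasurableSpace X] {f g : J → X → ℝ}
    (hf : ∀ j, Measurable (f j)) (hg : ∀ j, Measurable (g j)) :
    MeasurableSet {x | ∀ j, f j x ≤ g j x} := by
  rw [Set.ofPred_forall]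
  exact MeasurableSet.iInter fun j => measurableSet_le (hf j) (hg j)

lemma PolyMix.measurable {F : (n → ℝ) → ℝ≥0∞} (hF : PolyMix F) : Measurable F := by
  obtain ⟨J, _, α, κ, hκ, c, h⟩ := hF
  have := hκ.gauss
  rw [funext h]
  exact measurable_measure_prodMk_left (s := {p : (n → ℝ) × (J → ℝ) | ∀ j, (α *ᵥ p.1) j + p.2 j ≤ c j})
    (measurableSet_forall_le (fun j => by simp only [mulVec, dotProduct]; fun_prop)
      fun j => by fun_prop)

lemma PolyMix.le_one {F : (n → ℝ) → ℝ≥0∞} (hF : PolyMix F) (y : n → ℝ) : F y ≤ 1 := by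
  obtain ⟨J, _, α, κ, hκ, c, h⟩ := hF
  have := hκ.gauss
  rw [h]
  exact prob_le_one

lemma PolyMix.indicator {J : Type} [Fintype J] (α : Matrix J n ℝ) (c : J → ℝ) :
    PolyMix (Set.indicator {y : n → ℝ | ∀ j, (α *ᵥ y) j ≤ c j} 1) := by
  refine ⟨J, inferInstance, α, Measure.dirac 0, isCG_dirac, c, fun y => ?_⟩
  rw [Measure.dirac_apply' _ (measurableSet_forall_le (fun j => by fun_prop)
    fun j => by fun_prop)]
  simp [Set.indicator_apply]

/-- The linear map expressing both factors of the doubling operator at once. -/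
def doublingMap {J : Type*} (α : Matrix J n ℝ) [Fintype J] :
    ((n → ℝ) × (J → ℝ) × (J → ℝ)) →ₗ[ℝ] (J ⊕ J → ℝ) where
  toFun p := Sum.elim ((√2)⁻¹ • (α *ᵥ p.1) + p.2.1) (-((√2)⁻¹ • (α *ᵥ p.1)) + p.2.2)
  map_add' p q := by
    ext (j | j) <;> simp [mulVec_add] <;> ring
  map_smul' r p := by
    ext (j | j) <;> simp [mulVec_smul] <;> ring

lemma PolyMix.doubling {F : (n → ℝ) → ℝ≥0∞} (hF : PolyMix F) : PolyMix (doubling F) := by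
  obtain ⟨J, _, α, κ, hκ, c, h⟩ := hF
  have := hκ.gauss
  set T := (doublingMap α).toContinuousLinearMap with hT
  refine ⟨J ⊕ J, inferInstance, fromRows ((√2)⁻¹ • α) ((√2)⁻¹ • α),
    ((stdG n).prod (κ.prod κ)).map T, (isCG_stdG.prod (hκ.prod hκ)).map T, Sum.elim c c,
    fun u => ?_⟩
  have hm : MeasurableSet {w : J ⊕ J → ℝ | ∀ j,
      (fromRows ((√2)⁻¹ • α) ((√2)⁻¹ • α) *ᵥ u) j + w j ≤ Sum.elim c c j} :=
    measurableSet_forall_le (fun j => by fun_prop) fun j => by fun_prop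
  rw [Measure.map_apply (by fun_prop) hm, Measure.prod_apply (hm.preimage (by fun_prop))]
  refine lintegral_congr fun v => ?_
  rw [h, h, ← Measure.prod_prod]
  congr 1
  ext ⟨w, w'⟩
  simp [hT, doublingMap, mulVec_add, mulVec_neg, mulVec_smul, smul_mulVec, sub_eq_add_neg,
    add_assoc]
end

section
open scoped ENNReal
variable {n : Type*} [Fintype n] {A : Type*} [Fintype A]

/-- The linear map collecting the slab coordinates `α v_a + q_a` of all blocks. -/
def slabMap {J : Type*} [Fintype J] (A : Type*) (α : Matrix J n ℝ) :
    ((A → n → ℝ) × (A → J → ℝ)) →ₗ[ℝ] (A × J → ℝ) where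
  toFun p i := (α *ᵥ p.1 i.1) i.2 + p.2 i.1 i.2
  map_add' p q := by
    ext i
    simp [mulVec_add]
    ring
  map_smul' r p := by
    ext i
    simp [mulVec_smul]
    ring

/-- The product of the two factors of the doubling operator, as a mixture of symmetric slabs. -/
lemma mul_eq_lintegral_slab {J : Type*} [Fintype J] {α : Matrix J n ℝ} {κ : Measure (J → ℝ)}
    (hκ : IsCG κ) {c : J → ℝ} {F : (n → ℝ) → ℝ≥0∞}
    (h : ∀ y, F y = κ {w | ∀ j, (α *ᵥ y) j + w j ≤ c j}) (u v : n → ℝ) :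
    F ((√2)⁻¹ • (u + v)) * F ((√2)⁻¹ • (u - v)) =
      ∫⁻ p, κ {q | ∀ j, |(α *ᵥ v) j + q j| ≤ √2 * c j - (α *ᵥ u) j - p j} ∂κ := by
  have := hκ.gauss
  have h2 : (0 : ℝ) < √2 := by positivity
  have hm1 : MeasurableSet {z : (J → ℝ) × (J → ℝ) |
      (∀ j, (α *ᵥ ((√2)⁻¹ • (u + v))) j + z.1 j ≤ c j) ∧
        ∀ j, (α *ᵥ ((√2)⁻¹ • (u - v))) j + z.2 j ≤ c j} :=
    (measurableSet_forall_le (fun j => by fun_prop) fun j => by fun_prop).inter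
      (measurableSet_forall_le (fun j => by fun_prop) fun j => by fun_prop)
  have hprod : F ((√2)⁻¹ • (u + v)) * F ((√2)⁻¹ • (u - v)) = (κ.prod κ) {z |
      (∀ j, (α *ᵥ ((√2)⁻¹ • (u + v))) j + z.1 j ≤ c j) ∧
        ∀ j, (α *ᵥ ((√2)⁻¹ • (u - v))) j + z.2 j ≤ c j} := by
    rw [h, h, ← Measure.prod_prod]
    rfl
  rw [hprod, ← lintegral_indicator_one hm1,
    hκ.lintegral_rotate (measurable_one.indicator hm1)]
  have hm2 : MeasurableSet {z : (J → ℝ) × (J → ℝ) | ∀ j, |(α *ᵥ v) j + z.2 j| ≤ √2 * c j - (α *ᵥ u) j - z.1 j} :=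
    measurableSet_forall_le (fun j => by fun_prop) fun j => by fun_prop
  have he : ∀ z : (J → ℝ) × (J → ℝ), Set.indicator {z : (J → ℝ) × (J → ℝ) |
      (∀ j, (α *ᵥ ((√2)⁻¹ • (u + v))) j + z.1 j ≤ c j) ∧
        ∀ j, (α *ᵥ ((√2)⁻¹ • (u - v))) j + z.2 j ≤ c j} (1 : (J → ℝ) × (J → ℝ) → ℝ≥0∞)
        ((√2)⁻¹ • (z.1 + z.2), (√2)⁻¹ • (z.1 - z.2)) =
      Set.indicator {z : (J → ℝ) × (J → ℝ) | ∀ j, |(α *ᵥ v) j + z.2 j| ≤ √2 * c j - (α *ᵥ u) j - z.1 j} 1 z := by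
    intro z
    simp only [Set.indicator_apply, Set.mem_ofPred_eq, ← forall_and]
    congr 1
    refine propext (forall_congr' fun j => ?_)
    rw [abs_le]
    simp only [mulVec_smul, mulVec_add, mulVec_sub, Pi.smul_apply, Pi.add_apply, Pi.sub_apply,
      smul_eq_mul]
    rw [← mul_add, ← mul_add, inv_mul_le_iff₀ h2, inv_mul_le_iff₀ h2]
    constructor
    · rintro ⟨h1, h2⟩
      constructor <;> linarith
    · rintro ⟨h1, h2⟩
      constructor <;> linarith
  simp_rw [he]
  rw [lintegral_indicator_one hm2, Measure.prod_apply hm2]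
  rfl

lemma IsCG.prod_lintegral_slab_le {J : Type*} [Fintype J] (α : Matrix J n ℝ) {κ : Measure (J → ℝ)}
    (hκ : IsCG κ) {μ : Measure (A → n → ℝ)} (hμ : IsCG μ) (s : A → J → ℝ) :
    ∏ a, ∫⁻ v, κ {q | ∀ j, |(α *ᵥ v a) j + q j| ≤ s a j} ∂μ ≤
      ∫⁻ v, ∏ a, κ {q | ∀ j, |(α *ᵥ v a) j + q j| ≤ s a j} ∂μ := by
  have := hμ.gauss
  have := hκ.gauss
  have : IsProbabilityMeasure κ := inferInstance
  have : SFinite (Measure.pi fun _ : A => κ) := inferInstance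
  set ρ := (μ.prod (Measure.pi fun _ : A => κ)).map (slabMap A α).toContinuousLinearMap with hρdef
  have hρ : IsCG ρ := (hμ.prod (IsCG.pi fun _ => hκ)).map _
  refine (le_of_eq ?_).trans ((hρ.prod_slab_le s).trans_eq ?_)
  · refine Finset.prod_congr rfl fun a _ => ?_
    have hm : MeasurableSet {x : A × J → ℝ | ∀ j, |x (a, j)| ≤ s a j} :=
      measurableSet_forall_le (fun j => by fun_prop) fun j => by fun_prop
    rw [hρdef, Measure.map_apply (by fun_prop) hm, Measure.prod_apply (hm.preimage (by fun_prop))]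
    refine lintegral_congr fun v => ?_
    have hmq : MeasurableSet {q : J → ℝ | ∀ j, |(α *ᵥ v a) j + q j| ≤ s a j} :=
      measurableSet_forall_le (fun j => by fun_prop) fun j => by fun_prop
    exact ((measurePreserving_eval (fun _ : A => κ) a).measure_preimage
      hmq.nullMeasurableSet).symm
  · have hm : MeasurableSet {x : A × J → ℝ | ∀ a j, |x (a, j)| ≤ s a j} := by
      rw [Set.ofPred_forall]
      exact MeasurableSet.iInter fun a =>
        measurableSet_forall_le (fun j => by fun_prop) fun j => by fun_prop
    rw [hρdef, Measure.map_apply (by fun_prop) hm, Measure.prod_apply (hm.preimage (by fun_prop))]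
    refine lintegral_congr fun v => ?_
    rw [← Measure.pi_pi]
    congr 1
    ext q
    simp only [Set.mem_preimage, Set.mem_ofPred_eq, Set.mem_pi, Set.mem_univ, true_imp_iff]
    rfl

lemma PolyMix.prod_lintegral_le {F : (n → ℝ) → ℝ≥0∞} (hF : PolyMix F) {μ : Measure (A → n → ℝ)}
    (hμ : IsCG μ) (u : A → n → ℝ) :
    ∏ a, ∫⁻ v, F ((√2)⁻¹ • (u a + v a)) * F ((√2)⁻¹ • (u a - v a)) ∂μ ≤
      ∫⁻ v, ∏ a, F ((√2)⁻¹ • (u a + v a)) * F ((√2)⁻¹ • (u a - v a)) ∂μ := by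
  obtain ⟨J, _, α, κ, hκ, c, h⟩ := hF
  have := hκ.gauss
  have := hμ.gauss
  set s : A → (J → ℝ) → J → ℝ := fun a p j => √2 * c j - (α *ᵥ u a) j - p j with hs
  set G : A → (J → ℝ) → (n → ℝ) → ℝ≥0∞ :=
    fun a p v => κ {q | ∀ j, |(α *ᵥ v) j + q j| ≤ s a p j} with hG
  have hGm : ∀ a, Measurable fun z : (J → ℝ) × (n → ℝ) => G a z.1 z.2 := fun a =>
    measurable_measure_prodMk_left (s := {z : ((J → ℝ) × (n → ℝ)) × (J → ℝ) |
      ∀ j, |(α *ᵥ z.1.2) j + z.2 j| ≤ s a z.1.1 j})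
      (measurableSet_forall_le (fun j => by simp only [mulVec, dotProduct]; fun_prop)
        fun j => by simp only [hs]; fun_prop)
  have hfac : ∀ a v, F ((√2)⁻¹ • (u a + v)) * F ((√2)⁻¹ • (u a - v)) = ∫⁻ p, G a p v ∂κ :=
    fun a v => mul_eq_lintegral_slab hκ h (u a) v
  have hpt : ∀ p : A → J → ℝ, ∏ a, ∫⁻ v, G a (p a) (v a) ∂μ ≤
      ∫⁻ v, ∏ a, G a (p a) (v a) ∂μ := fun p =>
    hκ.prod_lintegral_slab_le α hμ fun a => s a (p a)
  have : IsProbabilityMeasure κ := inferInstance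
  clear_value G
  clear h hG hs s
  have hGm' : ∀ a, Measurable fun z : (A → n → ℝ) × (J → ℝ) => G a z.2 (z.1 a) := fun a =>
    (hGm a).comp (by fun_prop : Measurable fun z : (A → n → ℝ) × (J → ℝ) => (z.2, z.1 a))
  have hswap : ∫⁻ v, ∏ a, ∫⁻ p, G a p (v a) ∂κ ∂μ =
      ∫⁻ p, ∫⁻ v, ∏ a, G a (p a) (v a) ∂μ ∂Measure.pi fun _ : A => κ := by
    rw [lintegral_lintegral_swap]
    · refine lintegral_congr fun v => (lintegral_pi_prod (fun a => ?_)).symm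
      exact (hGm a).comp (by fun_prop : Measurable fun p : J → ℝ => (p, v a))
    · refine Measurable.aemeasurable (Finset.measurable_fun_prod _ fun a _ => ?_)
      exact (hGm a).comp
        (by fun_prop : Measurable fun z : (A → J → ℝ) × (A → n → ℝ) => (z.1 a, z.2 a))

  simp_rw [hfac]
  rw [hswap]
  refine le_trans (le_of_eq ?_) (lintegral_mono hpt)
  rw [lintegral_pi_prod (f := fun a p => ∫⁻ v, G a p (v a) ∂μ)]
  · exact Finset.prod_congr rfl fun a _ => lintegral_lintegral_swap (hGm' a).aemeasurable
  · intro a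
    exact ((hGm' a).comp measurable_swap).lintegral_prod_right'

/-- The doubling operator decreases the block integral at most to its square. -/
lemma PolyMix.lintegral_doubling_le {F : (n → ℝ) → ℝ≥0∞} (hF : PolyMix F)
    {μ : Measure (A → n → ℝ)} (hμ : IsCG μ) (hmarg : ∀ a, μ.map (fun y => y a) = stdG n) :
    ∫⁻ u, ∏ a, _root_.doubling F (u a) ∂μ ≤ (∫⁻ y, ∏ a, F (y a) ∂μ) ^ 2 := by
  have := hμ.gauss
  have hFm := hF.measurable
  have hm : Measurable fun y : A → n → ℝ => ∏ a, F (y a) :=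
    Finset.measurable_fun_prod _ fun a _ => hFm.comp (by fun_prop)
  rw [sq, ← lintegral_prod_mul hm.aemeasurable hm.aemeasurable,
    hμ.lintegral_rotate (f := fun z => (∏ a, F (z.1 a)) * ∏ a, F (z.2 a))
      ((hm.comp measurable_fst).mul (hm.comp measurable_snd)), lintegral_prod]
  · refine lintegral_mono fun u => ?_
    refine le_trans (le_of_eq ?_) ((hF.prod_lintegral_le hμ u).trans_eq ?_)
    · refine Finset.prod_congr rfl fun a _ => ?_
      rw [_root_.doubling, ← hmarg a, lintegral_map _ (by fun_prop)]
      exact (hFm.comp (by fun_prop)).mul (hFm.comp (by fun_prop))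
    · refine lintegral_congr fun v => ?_
      rw [← Finset.prod_mul_distrib]
      rfl
  · exact (((hm.comp measurable_fst).mul (hm.comp measurable_snd)).comp
      (by fun_prop : Measurable fun z : (A → n → ℝ) × (A → n → ℝ) =>
        ((√2)⁻¹ • (z.1 + z.2), (√2)⁻¹ • (z.1 - z.2)))).aemeasurable
end

section
open scoped ENNReal
variable {n : Type*} [Fintype n] {A : Type*} [Fintype A]

lemma withDensity_doubling {F : (n → ℝ) → ℝ≥0∞} (hF : Measurable F) :
    (stdG n).withDensity (doubling F) =
      (((stdG n).withDensity F).prod ((stdG n).withDensity F)).map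
        (fun p => (√2)⁻¹ • (p.1 + p.2)) := by
  have h2 : (√2 : ℝ)⁻¹ * ((√2)⁻¹ + (√2)⁻¹) = 1 := by
    rw [← two_mul, mul_left_comm, ← mul_inv, Real.mul_self_sqrt zero_le_two]
    norm_num
  ext s hs
  have hT : Measurable fun p : (n → ℝ) × (n → ℝ) => (√2)⁻¹ • (p.1 + p.2) := by fun_prop
  have hFF : Measurable fun z : (n → ℝ) × (n → ℝ) => F z.1 * F z.2 :=
    (hF.comp measurable_fst).mul (hF.comp measurable_snd)
  rw [prod_withDensity hF hF, Measure.map_apply hT hs, withDensity_apply _ (hT hs),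
    withDensity_apply _ hs, ← lintegral_indicator hs, ← lintegral_indicator (hT hs),
    isCG_stdG.lintegral_rotate (hFF.indicator (hT hs)), lintegral_prod _ (Measurable.aemeasurable ?_)]
  · refine lintegral_congr fun u => ?_
    have e : ∀ v : n → ℝ, (√2)⁻¹ • ((√2)⁻¹ • (u + v) + (√2)⁻¹ • (u - v)) = u := by
      intro v
      rw [← smul_add, add_add_sub_cancel, ← two_smul ℝ u, smul_smul, smul_smul]
      convert one_smul ℝ u
      linarith
    by_cases hu : u ∈ s
    · simp only [Set.indicator_of_mem hu, doubling]
      refine lintegral_congr fun v => ?_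
      rw [Set.indicator_of_mem]
      rw [Set.mem_preimage, e]
      exact hu
    · rw [Set.indicator_of_notMem hu, eq_comm, lintegral_eq_zero_iff']
      · refine Filter.Eventually.of_forall fun v => Set.indicator_of_notMem ?_ _
        rwa [Set.mem_preimage, e]
      · refine Measurable.aemeasurable ?_
        exact (hFF.indicator (hT hs)).comp
          (by fun_prop : Measurable fun v : n → ℝ => ((√2)⁻¹ • (u + v), (√2)⁻¹ • (u - v)))
  · exact (hFF.indicator (hT hs)).comp
      (by fun_prop : Measurable fun p : (n → ℝ) × (n → ℝ) =>
        ((√2)⁻¹ • (p.1 + p.2), (√2)⁻¹ • (p.1 - p.2)))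

/-- A finite measure with total mass `q`, zero first moments, and coordinate second moments
`V i * q`. -/
structure BalancedLaw (ν : Measure (n → ℝ)) (q : ℝ) (V : n → ℝ) : Prop where
  finite : IsFiniteMeasure ν
  mass : ν.real Set.univ = q
  memLp : ∀ i, MemLp (fun x => x i) 2 ν
  mean : ∀ i, ∫ x, x i ∂ν = 0
  second : ∀ i, ∫ x, x i ^ 2 ∂ν = V i * q

lemma BalancedLaw.convolve {ν : Measure (n → ℝ)} {q : ℝ} {V : n → ℝ} (h : BalancedLaw ν q V) :
    BalancedLaw ((ν.prod ν).map fun p => (√2)⁻¹ • (p.1 + p.2)) (q ^ 2) V := by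
  have := h.finite
  have hT : Measurable fun p : (n → ℝ) × (n → ℝ) => (√2)⁻¹ • (p.1 + p.2) := by fun_prop
  have h2 : ((√2 : ℝ)⁻¹) ^ 2 = 2⁻¹ := by rw [inv_pow, Real.sq_sqrt zero_le_two]
  have hL : ∀ i, MemLp (fun p : (n → ℝ) × (n → ℝ) => (√2)⁻¹ * (p.1 i + p.2 i)) 2 (ν.prod ν) :=
    fun i => ((h.memLp i).comp_fst ν |>.add ((h.memLp i).comp_snd ν)).const_mul _
  have hint : ∀ i, Integrable (fun x => x i) ν := fun i => (h.memLp i).integrable one_le_two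
  have hint2 : ∀ i, Integrable (fun x => x i ^ 2) ν := fun i => (h.memLp i).integrable_sq
  refine ⟨inferInstance, ?_, fun i => ?_, fun i => ?_, fun i => ?_⟩
  · rw [measureReal_def, Measure.map_apply hT MeasurableSet.univ, Set.preimage_univ,
      ← Set.univ_prod_univ, Measure.prod_prod, ENNReal.toReal_mul, ← measureReal_def, h.mass, sq]
  · rw [memLp_map_measure_iff (measurable_pi_apply i).aestronglyMeasurable hT.aemeasurable]
    exact hL i
  · rw [integral_map hT.aemeasurable (measurable_pi_apply i).aestronglyMeasurable]
    simp only [Pi.smul_apply, Pi.add_apply, smul_eq_mul]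
    rw [integral_const_mul, integral_add ((hint i).comp_fst ν) ((hint i).comp_snd ν),
      integral_fun_fst (fun x : n → ℝ => x i), integral_fun_snd (fun x : n → ℝ => x i), h.mean]
    simp
  · rw [integral_map hT.aemeasurable
      ((measurable_pi_apply i).pow_const 2).aestronglyMeasurable]
    simp only [Pi.smul_apply, Pi.add_apply, smul_eq_mul, mul_pow, h2]
    have e : ∀ p : (n → ℝ) × (n → ℝ),
        (p.1 i + p.2 i) ^ 2 = p.1 i ^ 2 + p.2 i ^ 2 + 2 * (p.1 i * p.2 i) := fun p => by ring
    simp_rw [e]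
    rw [integral_const_mul, integral_add, integral_add ((hint2 i).comp_fst ν)
      ((hint2 i).comp_snd ν), integral_fun_fst (fun x : n → ℝ => x i ^ 2),
      integral_fun_snd (fun x : n → ℝ => x i ^ 2), integral_const_mul,
      integral_prod_mul (fun x : n → ℝ => x i) (fun x : n → ℝ => x i), h.mean, h.second, h.mass]
    · simp only [smul_eq_mul]
      ring
    · exact ((hint2 i).comp_fst ν).add ((hint2 i).comp_snd ν)
    · exact ((hint i).mul_prod (hint i)).const_mul 2

lemma BalancedLaw.half_le {ν : Measure (n → ℝ)} {q : ℝ} {V : n → ℝ} (h : BalancedLaw ν q V)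
    {R : ℝ} (hR0 : 0 < R) (hR : 2 * ∑ i, V i ≤ R ^ 2) :
    q / 2 ≤ ν.real (Set.univ.pi fun _ => Set.Icc (-R) R) := by
  have := h.finite
  have hint2 : ∀ i, Integrable (fun x => x i ^ 2) ν := fun i => (h.memLp i).integrable_sq
  have hq : 0 ≤ q := h.mass ▸ measureReal_nonneg
  have hch := mul_meas_ge_le_integral_of_nonneg (μ := ν) (f := fun x : n → ℝ => ∑ i, x i ^ 2)
    (Filter.Eventually.of_forall fun x => Finset.sum_nonneg fun i _ => sq_nonneg _)
    (integrable_finsetSum _ fun i _ => hint2 i) (R ^ 2)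
  rw [integral_finsetSum _ fun i _ => hint2 i] at hch
  simp_rw [h.second] at hch
  rw [← Finset.sum_mul] at hch
  have hle : ν.real {x : n → ℝ | R ^ 2 ≤ ∑ i, x i ^ 2} ≤ q / 2 := by
    refine le_of_mul_le_mul_left (hch.trans ?_) (by positivity : 0 < R ^ 2)
    nlinarith
  have hcov : (Set.univ : Set (n → ℝ)) ⊆ (Set.univ.pi fun _ => Set.Icc (-R) R) ∪
      {x : n → ℝ | R ^ 2 ≤ ∑ i, x i ^ 2} := by
    intro x _
    by_cases hx : R ^ 2 ≤ ∑ i, x i ^ 2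
    · exact Or.inr hx
    · refine Or.inl fun i _ => abs_le.1 (abs_le_of_sq_le_sq ?_ hR0.le)
      exact (Finset.single_le_sum (fun i _ => sq_nonneg (x i)) (Finset.mem_univ i)).trans
        (not_le.1 hx).le
  have := (measureReal_mono hcov (measure_ne_top ν _)).trans (measureReal_union_le _ _)
  rw [h.mass] at this
  linarith

lemma PolyMix.iterate {F : (n → ℝ) → ℝ≥0∞} (hF : PolyMix F) (k : ℕ) :
    PolyMix (_root_.doubling^[k] F) := by
  induction k with
  | zero => exact hF
  | succ k ih => rw [Function.iterate_succ_apply']; exact ih.doubling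

lemma PolyMix.balanced {F : (n → ℝ) → ℝ≥0∞} (hF : PolyMix F)
    (h0 : ∀ i, ∫ x, x i ∂(stdG n).withDensity F = 0)
    (hq : 0 < ((stdG n).withDensity F).real Set.univ) :
    ∃ V, ∀ k, BalancedLaw ((stdG n).withDensity (_root_.doubling^[k] F))
      (((stdG n).withDensity F).real Set.univ ^ 2 ^ k) V := by
  set q := ((stdG n).withDensity F).real Set.univ with hqdef
  refine ⟨fun i => (∫ x, x i ^ 2 ∂(stdG n).withDensity F) / q, fun k => ?_⟩
  induction k with
  | zero =>
    have hle : (stdG n).withDensity F ≤ stdG n := by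
      conv_rhs => rw [← withDensity_one (μ := stdG n)]
      exact withDensity_mono (Filter.Eventually.of_forall hF.le_one)
    refine ⟨isFiniteMeasure_of_le _ hle, by simp [hqdef], fun i => ?_, h0, fun i => ?_⟩
    · refine MemLp.mono_measure hle ?_
      exact (memLp_id_gaussianReal (μ := 0) (v := 1) 2).comp_measurePreserving
        (measurePreserving_eval (fun _ : n => gaussianReal 0 1) i)
    · simp only [Function.iterate_zero, id_eq, pow_zero, pow_one]
      rw [div_mul_cancel₀ _ hq.ne']
  | succ k ih =>
    rw [Function.iterate_succ_apply', withDensity_doubling (hF.iterate k).measurable, pow_succ,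
      pow_mul]
    exact ih.convolve
end

section
open scoped ENNReal NNReal
variable {n : Type*} [Fintype n] {A : Type*} [Fintype A]

lemma smul_restrict_le_pi {ν lam : n → Measure ℝ} [∀ i, SigmaFinite (ν i)]
    [∀ i, SigmaFinite (lam i)] {I : Set ℝ} (hI : MeasurableSet I) {k : ℝ≥0∞}
    (h : ∀ i, k • (ν i).restrict I ≤ lam i) :
    k ^ Fintype.card n • (Measure.pi ν).restrict (Set.univ.pi fun _ => I) ≤ Measure.pi lam := by
  have hIm : MeasurableSet (Set.univ.pi fun _ : n => I) := MeasurableSet.univ_pi fun _ => hI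
  have key : (k ^ Fintype.card n •
      (Measure.pi ν).restrict (Set.univ.pi fun _ => I)).toOuterMeasure ≤
      OuterMeasure.pi fun i => (lam i).toOuterMeasure := by
    rw [OuterMeasure.le_pi]
    intro s _
    change (k ^ Fintype.card n • (Measure.pi ν).restrict (Set.univ.pi fun _ => I)) _ ≤
      ∏ i, lam i (s i)
    rw [Measure.smul_apply, Measure.restrict_apply' hIm, ← Set.pi_inter_distrib, Measure.pi_pi,
      smul_eq_mul, ← Finset.card_univ, ← Finset.prod_const, ← Finset.prod_mul_distrib]
    refine Finset.prod_le_prod' fun i _ => ?_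
    have := h i (s i)
    rwa [Measure.smul_apply, Measure.restrict_apply' hI] at this
  refine Measure.le_iff.2 fun s hs => (key s).trans ?_
  rw [Measure.pi_def]
  exact le_toMeasure_apply _ _ s

lemma exists_smul_restrict_le_gaussianReal {v : ℝ≥0} (hv : v ≠ 0) (M R : ℝ) :
    ∃ k : ℝ≥0∞, k ≠ 0 ∧ ∀ m, |m| ≤ M →
      k • (gaussianReal 0 1).restrict (Set.Icc (-R) R) ≤ gaussianReal m v := by
  have hv' : (0 : ℝ) < v := by positivity
  set k : ℝ := √(2 * Real.pi * (1 : ℝ≥0)) * ((√(2 * Real.pi * v))⁻¹ *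
    Real.exp (-(R + M) ^ 2 / (2 * v))) with hk
  have hk0 : 0 < k := by positivity
  refine ⟨ENNReal.ofReal k, by simpa using hk0, fun m hm => Measure.le_iff.2 fun s hs => ?_⟩
  rw [Measure.smul_apply, Measure.restrict_apply hs, gaussianReal_apply _ one_ne_zero,
    gaussianReal_apply _ hv, smul_eq_mul, ← lintegral_const_mul _ (by fun_prop)]
  refine (setLIntegral_mono' (hs.inter measurableSet_Icc) fun x hx => ?_).trans
    (lintegral_mono_set Set.inter_subset_left)
  rw [gaussianPDF, gaussianPDF, ← ENNReal.ofReal_mul hk0.le]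
  refine ENNReal.ofReal_le_ofReal ?_
  simp only [gaussianPDFReal]
  have hx' : |x - m| ≤ R + M := (abs_sub _ _).trans (add_le_add (abs_le.2 hx.2) hm)
  have h1 : Real.exp (-(x - 0) ^ 2 / (2 * (1 : ℝ≥0))) ≤ 1 := by
    rw [Real.exp_le_one_iff, neg_div]
    have : 0 ≤ (x - 0) ^ 2 / (2 * ((1 : ℝ≥0) : ℝ)) := by positivity
    linarith
  have h2 : Real.exp (-(R + M) ^ 2 / (2 * v)) ≤ Real.exp (-(x - m) ^ 2 / (2 * v)) := by
    have := sq_le_sq' (abs_le.1 hx').1 (abs_le.1 hx').2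
    exact Real.exp_le_exp.2 (div_le_div_of_nonneg_right (neg_le_neg this) (by positivity))
  have h3 : (0 : ℝ) < √(2 * Real.pi * (1 : ℝ≥0)) := by positivity
  calc k * ((√(2 * Real.pi * (1 : ℝ≥0)))⁻¹ * Real.exp (-(x - 0) ^ 2 / (2 * (1 : ℝ≥0))))
      ≤ k * ((√(2 * Real.pi * (1 : ℝ≥0)))⁻¹ * 1) := by gcongr
    _ = (√(2 * Real.pi * v))⁻¹ * Real.exp (-(R + M) ^ 2 / (2 * v)) := by
        rw [hk]; field_simp
    _ ≤ _ := by gcongr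

lemma exists_mul_lintegral_le {s : ℝ} (hs : s ≠ 0) (c M R : ℝ) :
    ∃ k : ℝ≥0∞, k ≠ 0 ∧ ∀ y : n → ℝ, (∀ i, |y i| ≤ M) → ∀ f : (n → ℝ) → ℝ≥0∞, Measurable f →
      k * ∫⁻ x in Set.univ.pi fun _ => Set.Icc (-R) R, f x ∂stdG n ≤
        ∫⁻ z, f (c • y + s • z) ∂stdG n := by
  set v : ℝ≥0 := ⟨s ^ 2, sq_nonneg s⟩ with hvdef
  have hv : v ≠ 0 := by
    rw [Ne, ← NNReal.coe_eq_zero]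
    exact pow_ne_zero 2 hs
  obtain ⟨k, hk0, hk⟩ := exists_smul_restrict_le_gaussianReal hv (|c| * M) R
  refine ⟨k ^ Fintype.card n, pow_ne_zero _ hk0, fun y hy f hf => ?_⟩
  have hmap : (stdG n).map (fun z => c • y + s • z) =
      Measure.pi fun i => gaussianReal (c * y i) v := by
    have h1 : ∀ i, (gaussianReal 0 1).map (fun z => c * y i + s * z) =
        gaussianReal (c * y i) v := by
      intro i
      rw [← Function.comp_def (fun z => c * y i + z) (fun z => s * z),
        ← Measure.map_map (by fun_prop) (by fun_prop), gaussianReal_map_const_mul,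
        gaussianReal_map_const_add]
      simp [hvdef]
      rfl
    have : ∀ i : n, SigmaFinite ((gaussianReal 0 1).map (fun z => c * y i + s * z)) :=
      fun i => by rw [h1]; infer_instance
    have := Measure.pi_map_pi (μ := fun _ : n => gaussianReal 0 1)
      (f := fun i z => c * y i + s * z) fun i => by fun_prop
    simp_rw [h1] at this
    exact this
  rw [← lintegral_map (μ := stdG n) hf (by fun_prop : Measurable fun z : n → ℝ => c • y + s • z),
    hmap, ← smul_eq_mul, ← lintegral_smul_measure]
  refine lintegral_mono' (smul_restrict_le_pi measurableSet_Icc fun i => hk _ ?_) le_rfl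
  rw [abs_mul]
  exact mul_le_mul_of_nonneg_left (hy i) (abs_nonneg c)

lemma le_of_forall_mul_pow_le {p Q K : ℝ≥0∞} (hK : K ≠ 0) (hQ : Q ≠ ∞)
    (h : ∀ k : ℕ, K * Q ^ 2 ^ k ≤ p ^ 2 ^ k) : Q ≤ p := by
  by_contra! hlt
  have hQ0 : Q ≠ 0 := (zero_le.trans_lt hlt).ne'
  have hr : p / Q < 1 := by
    rw [ENNReal.div_lt_iff (Or.inl hQ0) (Or.inl hQ), one_mul]
    exact hlt
  have hlim := (ENNReal.tendsto_pow_atTop_nhds_zero_of_lt_one hr).comp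
    (tendsto_pow_atTop_atTop_of_one_lt (r := 2) one_lt_two)
  have : K ≤ 0 := by
    refine ge_of_tendsto' hlim fun k => ?_
    simp only [Function.comp]
    rw [div_eq_mul_inv, mul_pow, ← ENNReal.inv_pow, ← div_eq_mul_inv,
      ENNReal.le_div_iff_mul_le (Or.inl (pow_ne_zero _ hQ0))
      (Or.inl (ENNReal.pow_ne_top hQ))]
    exact h k
  exact hK (le_antisymm this zero_le)
end

section
open scoped ENNReal NNReal Topology
variable {n : Type*} [Fintype n] {A : Type*} [Fintype A]

/-- The law of `cos θ • Y + sin θ • Z`, with `Y ∼ μ` and `Z` independent standard Gaussian. -/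
def perturb (μ : Measure (A → n → ℝ)) (θ : ℝ) : Measure (A → n → ℝ) :=
  (μ.prod (Measure.pi fun _ : A => stdG n)).map
    (Real.cos θ • ContinuousLinearMap.fst ℝ (A → n → ℝ) (A → n → ℝ) +
      Real.sin θ • ContinuousLinearMap.snd ℝ (A → n → ℝ) (A → n → ℝ))

lemma isCG_perturb {μ : Measure (A → n → ℝ)} (hμ : IsCG μ) (θ : ℝ) : IsCG (perturb μ θ) :=
  (hμ.prod (IsCG.pi fun _ => isCG_stdG)).map _

lemma lintegral_perturb {μ : Measure (A → n → ℝ)} [SFinite μ] (θ : ℝ) {f : (A → n → ℝ) → ℝ≥0∞}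
    (hf : Measurable f) : ∫⁻ x, f x ∂perturb μ θ =
      ∫⁻ y, ∫⁻ z, f (Real.cos θ • y + Real.sin θ • z) ∂(Measure.pi fun _ : A => stdG n) ∂μ := by
  rw [perturb, lintegral_map hf (by fun_prop), lintegral_prod]
  · rfl
  · exact (hf.comp (by fun_prop)).aemeasurable

lemma map_perturb {μ : Measure (A → n → ℝ)} (hμ : IsCG μ)
    (hmarg : ∀ a, μ.map (fun y => y a) = stdG n) (θ : ℝ) (a : A) :
    (perturb μ θ).map (fun y => y a) = stdG n := by
  have := hμ.gauss
  ext s hs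
  have hev : Measurable fun y : A → n → ℝ => y a := by fun_prop
  have hT : Measurable fun p : (n → ℝ) × (n → ℝ) => Real.cos θ • p.1 + Real.sin θ • p.2 := by
    fun_prop
  have hrot : ((stdG n).prod (stdG n)).map
      (fun p => Real.cos θ • p.1 + Real.sin θ • p.2) = stdG n := by
    have h1 := congrArg (fun m => m.map Prod.fst) (isCG_stdG (ι := n) |>.map_rotation θ)
    simp only [Measure.map_fst_prod, measure_univ, one_smul] at h1
    rwa [Measure.map_map measurable_fst (ContinuousLinearMap.measurable _)] at h1
  have hpair : (μ.prod (Measure.pi fun _ : A => stdG n)).map (fun p => (p.1 a, p.2 a)) =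
      (stdG n).prod (stdG n) := by
    have := Measure.map_prod_map μ (Measure.pi fun _ : A => stdG n) hev hev
    rw [hmarg, (measurePreserving_eval (fun _ : A => stdG n) a).map_eq] at this
    exact this.symm
  have hcomp := congrArg (fun m => m.map
    (fun p : (n → ℝ) × (n → ℝ) => Real.cos θ • p.1 + Real.sin θ • p.2)) hpair
  simp only [hrot] at hcomp
  rw [Measure.map_map hT (by fun_prop)] at hcomp
  rw [← hcomp, perturb, Measure.map_map hev (ContinuousLinearMap.measurable _)]
  rfl

lemma exists_measure_box_ne_zero (μ : Measure (A → n → ℝ)) [IsProbabilityMeasure μ] :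
    ∃ M : ℝ, μ {y | ∀ a i, |y a i| ≤ M} ≠ 0 := by
  by_contra! h
  have hU : (⋃ N : ℕ, {y : A → n → ℝ | ∀ a i, |y a i| ≤ N}) = Set.univ := by
    refine Set.eq_univ_of_forall fun y => Set.mem_iUnion.2 ?_
    obtain ⟨N, hN⟩ := exists_nat_ge ‖y‖
    refine ⟨N, fun a i => ?_⟩
    exact ((norm_le_pi_norm (y a) i).trans (norm_le_pi_norm y a)).trans hN
  have := measure_iUnion_null (μ := μ) fun N : ℕ => h N
  rw [hU, measure_univ] at this
  exact one_ne_zero this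

lemma PolyMix.lintegral_iterate_le {F : (n → ℝ) → ℝ≥0∞} (hF : PolyMix F)
    {μ : Measure (A → n → ℝ)} (hμ : IsCG μ) (hmarg : ∀ a, μ.map (fun y => y a) = stdG n) (k : ℕ) :
    ∫⁻ y, ∏ a, (_root_.doubling^[k] F) (y a) ∂μ ≤ (∫⁻ y, ∏ a, F (y a) ∂μ) ^ 2 ^ k := by
  induction k with
  | zero => simp
  | succ k ih =>
    simp_rw [Function.iterate_succ_apply']
    refine ((hF.iterate k).lintegral_doubling_le hμ hmarg).trans ?_
    rw [pow_succ 2 k, pow_mul]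
    exact pow_le_pow_left' ih 2

lemma PolyMix.pow_le_lintegral_perturb [Nonempty A] {F : (n → ℝ) → ℝ≥0∞} (hF : PolyMix F)
    (h0 : ∀ i, ∫ x, x i ∂(stdG n).withDensity F = 0) {μ : Measure (A → n → ℝ)} (hμ : IsCG μ)
    (hmarg : ∀ a, μ.map (fun y => y a) = stdG n) {θ : ℝ} (hθ : Real.sin θ ≠ 0) :
    ((stdG n).withDensity F Set.univ) ^ Fintype.card A ≤ ∫⁻ y, ∏ a, F (y a) ∂perturb μ θ := by
  have := hμ.gauss
  have hle : (stdG n).withDensity F ≤ stdG n := by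
    conv_rhs => rw [← withDensity_one (μ := stdG n)]
    exact withDensity_mono (Filter.Eventually.of_forall hF.le_one)
  have := isFiniteMeasure_of_le _ hle
  set q := (stdG n).withDensity F Set.univ with hq
  have hqt : q ≠ ∞ := measure_ne_top _ _
  by_cases hq0 : q = 0
  · rw [hq0, zero_pow Fintype.card_ne_zero]
    exact zero_le
  have hqr : 0 < ((stdG n).withDensity F).real Set.univ := ENNReal.toReal_pos hq0 hqt
  obtain ⟨V, hV⟩ := hF.balanced h0 hqr
  set R : ℝ := √(2 * |∑ i, V i|) + 1 with hR
  have hR0 : 0 < R := by positivity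
  have hR2 : 2 * ∑ i, V i ≤ R ^ 2 := by
    have h1 : √(2 * |∑ i, V i|) ^ 2 = 2 * |∑ i, V i| := Real.sq_sqrt (by positivity)
    have h2 := le_abs_self (∑ i, V i)
    have h3 := Real.sqrt_nonneg (2 * |∑ i, V i|)
    rw [hR]
    nlinarith
  obtain ⟨M, hM⟩ := exists_measure_box_ne_zero μ
  obtain ⟨c, hc0, hc⟩ := exists_mul_lintegral_le (n := n) hθ (Real.cos θ) M R
  have hcube : ∀ k : ℕ, q ^ 2 ^ k / 2 ≤
      ∫⁻ x in Set.univ.pi fun _ => Set.Icc (-R) R, (_root_.doubling^[k] F) x ∂stdG n := by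
    intro k
    have hb := (hV k).half_le hR0 hR2
    have := (hV k).finite
    rw [← withDensity_apply _ (MeasurableSet.univ_pi fun _ => measurableSet_Icc)]
    rw [← ENNReal.toReal_le_toReal (ENNReal.div_ne_top (ENNReal.pow_ne_top hqt) two_ne_zero)
      (measure_ne_top _ _), ENNReal.toReal_div, ENNReal.toReal_pow]
    exact hb
  have hprob : IsProbabilityMeasure (perturb μ θ) :=
    have := (isCG_perturb hμ θ).gauss
    inferInstance
  refine le_of_forall_mul_pow_le (K := (c / 2) ^ Fintype.card A * μ {y | ∀ a i, |y a i| ≤ M})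
    (mul_ne_zero (pow_ne_zero _ (ENNReal.div_ne_zero.2 ⟨hc0, ENNReal.ofNat_ne_top⟩)) hM)
    (ENNReal.pow_ne_top hqt) fun k => ?_
  · refine le_trans ?_ (hF.lintegral_iterate_le (isCG_perturb hμ θ) (map_perturb hμ hmarg θ) k)
    have hD := (hF.iterate k).measurable
    have hDm : Measurable fun y : A → n → ℝ => ∏ a, (_root_.doubling^[k] F) (y a) :=
      Finset.measurable_fun_prod _ fun a _ => hD.comp (measurable_pi_apply a)
    rw [lintegral_perturb θ hDm]
    have hbox : MeasurableSet {y : A → n → ℝ | ∀ a i, |y a i| ≤ M} := by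
      rw [Set.ofPred_forall]
      exact MeasurableSet.iInter fun a =>
        measurableSet_forall_le (fun i => by fun_prop) fun i => by fun_prop
    calc (c / 2) ^ Fintype.card A * μ {y | ∀ a i, |y a i| ≤ M} * (q ^ Fintype.card A) ^ 2 ^ k
        = ∫⁻ y in {y | ∀ a i, |y a i| ≤ M}, ∏ _a : A, (c * (q ^ 2 ^ k / 2)) ∂μ := by
          rw [setLIntegral_const, Finset.prod_const, Finset.card_univ, mul_right_comm,
            ← pow_mul, mul_comm (Fintype.card A), pow_mul, ← mul_pow, div_eq_mul_inv,
            div_eq_mul_inv, mul_right_comm, mul_assoc c]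
      _ ≤ ∫⁻ y in {y | ∀ a i, |y a i| ≤ M}, ∫⁻ z, ∏ a, (_root_.doubling^[k] F)
            ((Real.cos θ • y + Real.sin θ • z) a) ∂(Measure.pi fun _ : A => stdG n) ∂μ := by
          refine setLIntegral_mono' hbox fun y hy => ?_
          refine le_of_le_of_eq ?_ (lintegral_pi_prod (μ := fun _ : A => stdG n)
            (f := fun a z => (_root_.doubling^[k] F) (Real.cos θ • y a + Real.sin θ • z))
            fun a => hD.comp (by fun_prop)).symm
          exact Finset.prod_le_prod' fun a _ =>
            (mul_le_mul_right (hcube k) c).trans (hc (y a) (hy a) _ hD)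
      _ ≤ _ := setLIntegral_le_lintegral _ _

/-- A product lower bound for the probability that all blocks of a Gaussian vector with standard
blocks lie in a polytope whose Gaussian barycenter is the origin. -/
theorem pow_measure_polytope_le [Nonempty A] {J : Type} [Fintype J] (α : Matrix J n ℝ) (c : J → ℝ)
    (h0 : ∀ i, ∫ x in {y : n → ℝ | ∀ j, (α *ᵥ y) j ≤ c j}, x i ∂stdG n = 0)
    {μ : Measure (A → n → ℝ)} (hμ : IsCG μ) (hmarg : ∀ a, μ.map (fun y => y a) = stdG n) :
    (stdG n {y | ∀ j, (α *ᵥ y) j ≤ c j}) ^ Fintype.card A ≤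
      μ {y | ∀ a j, (α *ᵥ y a) j ≤ c j} := by
  have := hμ.gauss
  set K : Set (n → ℝ) := {y | ∀ j, (α *ᵥ y) j ≤ c j} with hK
  have hKm : MeasurableSet K :=
    measurableSet_forall_le (fun j => by simp only [mulVec, dotProduct]; fun_prop)
      fun j => by fun_prop
  have hKc : IsClosed K := by
    rw [hK, Set.ofPred_forall]
    refine isClosed_iInter fun j => isClosed_le ?_ continuous_const
    simp only [mulVec, dotProduct]
    fun_prop
  set G : Set (A → n → ℝ) := {y | ∀ a, y a ∈ K} with hG
  have hGm : MeasurableSet G := by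
    rw [hG, Set.ofPred_forall]
    exact MeasurableSet.iInter fun a => hKm.preimage (by fun_prop)
  have hGc : IsClosed G := by
    rw [hG, Set.ofPred_forall]
    exact isClosed_iInter fun a => hKc.preimage (by fun_prop)
  have hF : PolyMix (K.indicator 1) := PolyMix.indicator α c
  have hwd : (stdG n).withDensity (K.indicator 1) = (stdG n).restrict K := by
    rw [withDensity_indicator hKm, withDensity_one]
  set θ : ℕ → ℝ := fun N => 1 / (N + 1 : ℝ) with hθ
  have hθ0 : ∀ N, Real.sin (θ N) ≠ 0 := fun N => (Real.sin_pos_of_pos_of_le_one (by positivity)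
    (by rw [hθ]; exact (div_le_one (by positivity)).2 (by simp))).ne'
  have hθl : Filter.Tendsto θ Filter.atTop (𝓝 0) := tendsto_one_div_add_atTop_nhds_zero_nat
  set P := μ.prod (Measure.pi fun _ : A => stdG n) with hP
  set T : ℕ → (A → n → ℝ) × (A → n → ℝ) → (A → n → ℝ) :=
    fun N p => Real.cos (θ N) • p.1 + Real.sin (θ N) • p.2 with hT
  have hTm : ∀ N, Measurable (T N) := fun N => by fun_prop
  have hbound : ∀ N, (stdG n K) ^ Fintype.card A ≤
      ∫⁻ p, G.indicator 1 (T N p) ∂P := by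
    intro N
    have := hF.pow_le_lintegral_perturb (by rwa [hwd]) hμ hmarg (hθ0 N)
    rw [hwd, Measure.restrict_apply_univ] at this
    refine this.trans_eq ?_
    have hKp : Measurable fun y : A → n → ℝ => ∏ a, K.indicator (1 : (n → ℝ) → ℝ≥0∞) (y a) :=
      Finset.measurable_fun_prod _ fun a _ => hF.measurable.comp (measurable_pi_apply a)
    rw [perturb]
    refine (lintegral_map hKp (ContinuousLinearMap.measurable _)).trans ?_
    refine lintegral_congr fun p => ?_
    simp only [Set.indicator_apply, Pi.one_apply, Finset.prod_ite_zero, Finset.prod_const_one]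
    congr 1
    simp [hG, hT]
  have hfatou := limsup_lintegral_le (μ := P) (f := fun N p => G.indicator 1 (T N p)) 1
    (fun N => (measurable_one.indicator hGm).comp (hTm N))
    (fun N => Filter.Eventually.of_forall fun p => Set.indicator_le_self' (by simp) _)
    (by simp)
  have hlow : (stdG n K) ^ Fintype.card A ≤
      Filter.limsup (fun N => ∫⁻ p, G.indicator 1 (T N p) ∂P) Filter.atTop :=
    (Filter.le_limsup_of_frequently_le (Filter.Frequently.of_forall hbound))
  refine hlow.trans (hfatou.trans ?_)
  calc ∫⁻ p, Filter.limsup (fun N => G.indicator 1 (T N p)) Filter.atTop ∂P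
      ≤ ∫⁻ p, G.indicator 1 p.1 ∂P := by
        refine lintegral_mono fun p => ?_
        by_cases hp : p.1 ∈ G
        · rw [Set.indicator_of_mem hp]
          exact Filter.limsup_le_of_le (by isBoundedDefault)
            (Filter.Eventually.of_forall fun N => Set.indicator_le_self' (by simp) _)
        · have hlim : Filter.Tendsto (fun N => T N p) Filter.atTop (𝓝 p.1) := by
            have := ((Real.continuous_cos.tendsto 0).comp hθl).smul_const p.1 |>.add
              (((Real.continuous_sin.tendsto 0).comp hθl).smul_const p.2)
            simpa using this
          have hev : ∀ᶠ N in Filter.atTop, G.indicator (1 : (A → n → ℝ) → ℝ≥0∞) (T N p) ≤ 0 := by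
            filter_upwards [hlim.eventually (hGc.isOpen_compl.mem_nhds hp)] with N hN
            rw [Set.indicator_of_notMem hN]
          exact (Filter.limsup_le_of_le (by isBoundedDefault) hev).trans zero_le
    _ = μ G := by
        have hGf : Measurable fun p : (A → n → ℝ) × (A → n → ℝ) =>
            G.indicator (1 : (A → n → ℝ) → ℝ≥0∞) p.1 :=
          (measurable_one.indicator hGm).comp measurable_fst
        rw [hP, lintegral_prod _ hGf.aemeasurable]
        simp [lintegral_indicator_one hGm]
end

section
open scoped ENNReal
variable {n : Type*} [Fintype n] [DecidableEq n]

/-- The orthogonal projection onto the vectors with zero coordinate sum. -/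
def centering (n : Type*) [Fintype n] [DecidableEq n] : Matrix n n ℝ :=
  1 - Matrix.of fun _ _ => (Fintype.card n : ℝ)⁻¹

lemma centering_apply (i j : n) :
    centering n i j = (if i = j then 1 else 0) - (Fintype.card n : ℝ)⁻¹ := by
  simp [centering, Matrix.one_apply]

lemma centering_mulVec (y : n → ℝ) (i : n) :
    (centering n *ᵥ y) i = y i - (Fintype.card n : ℝ)⁻¹ * ∑ j, y j := by
  simp [mulVec, dotProduct, centering_apply, sub_mul, Finset.sum_sub_distrib, Finset.mul_sum]

lemma centering_mul_transpose [Nonempty n] : centering n * (centering n)ᵀ = centering n := by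
  have hc : (Fintype.card n : ℝ) ≠ 0 := by positivity
  ext i j
  rw [mul_apply]
  change (centering n *ᵥ fun k => centering n j k) i = _
  rw [centering_mulVec]
  simp only [centering_apply, Finset.sum_sub_distrib, Finset.sum_ite_eq, Finset.mem_univ, if_true,
    Finset.sum_const, Finset.card_univ, nsmul_eq_mul, mul_inv_cancel₀ hc, sub_self, mul_zero,
    sub_zero, eq_comm]

lemma map_mulVec_stdG {M : Matrix n n ℝ} (hM : M * Mᵀ = 1) :
    (stdG n).map (fun x => M *ᵥ x) = stdG n := by
  have h := hasGauss_map_stdG M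
  rw [hM] at h
  exact h.ext hasGauss_stdG

lemma setIntegral_stdG_mulVec {M : Matrix n n ℝ} (hM : M * Mᵀ = 1) {K : Set (n → ℝ)}
    (hK : MeasurableSet K) (hMK : ∀ x, M *ᵥ x ∈ K ↔ x ∈ K) (i : n) :
    ∫ x in K, (M *ᵥ x) i ∂stdG n = ∫ x in K, x i ∂stdG n := by
  have hMm : Measurable fun x : n → ℝ => M *ᵥ x :=
    measurable_pi_iff.2 fun i => by simp only [mulVec, dotProduct]; fun_prop
  rw [← integral_indicator hK, ← integral_indicator hK]
  conv_rhs => rw [← map_mulVec_stdG hM]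
  rw [integral_map hMm.aemeasurable
    ((measurable_pi_apply i).indicator hK).aestronglyMeasurable]
  refine integral_congr_ae (.of_forall fun x => ?_)
  classical
  simp only [Set.indicator_apply, hMK]

lemma integrable_eval_stdG {n : Type*} [Fintype n] (i : n) : Integrable (fun x : n → ℝ => x i) (stdG n) := by
  have h : Integrable (fun x : ℝ => x) (gaussianReal 0 1) :=
    (memLp_id_gaussianReal 1).integrable le_rfl
  exact (measurePreserving_eval (fun _ : n => gaussianReal 0 1) i).integrable_comp_of_integrable h

/-- The Gaussian vectors whose centered coordinates are at most `t`. -/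
def centeredLE (n : Type*) [Fintype n] [DecidableEq n] (t : ℝ) : Set (n → ℝ) :=
  {y | ∀ j, (centering n *ᵥ y) j ≤ t}

lemma measurableSet_centeredLE (t : ℝ) : MeasurableSet (centeredLE n t) :=
  measurableSet_forall_le (fun j => by simp only [mulVec, dotProduct]; fun_prop)
    fun j => by fun_prop

lemma setIntegral_eval_centeredLE (t : ℝ) (i : n) :
    ∫ x in centeredLE n t, x i ∂stdG n = 0 := by
  have hc : (Fintype.card n : ℝ) ≠ 0 := by
    have := Fintype.card_pos_iff.2 ⟨i⟩
    positivity
  have hswap : ∀ j, ∫ x in centeredLE n t, x j ∂stdG n = ∫ x in centeredLE n t, x i ∂stdG n := by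
    intro j
    have hM : ((Equiv.swap i j).toPEquiv.toMatrix : Matrix n n ℝ) *
        ((Equiv.swap i j).toPEquiv.toMatrix : Matrix n n ℝ)ᵀ = 1 := by
      rw [← PEquiv.toMatrix_symm, ← PEquiv.toMatrix_trans, ← Equiv.toPEquiv_symm,
        ← Equiv.toPEquiv_trans, Equiv.self_trans_symm, Equiv.toPEquiv_refl, PEquiv.toMatrix_refl]
    have hv : ∀ x : n → ℝ, ((Equiv.swap i j).toPEquiv.toMatrix : Matrix n n ℝ) *ᵥ x =
        fun k => x (Equiv.swap i j k) := fun x => by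
      rw [PEquiv.toMatrix_toPEquiv_mulVec]; rfl
    have := setIntegral_stdG_mulVec hM (measurableSet_centeredLE t) (fun x => ?_) i
    · simpa [hv] using this
    · simp only [hv, centeredLE, Set.mem_ofPred_eq, centering_mulVec]
      rw [Equiv.sum_comp (Equiv.swap i j) x]
      exact (Equiv.swap i j).forall_congr_right (q := fun k => x k - _ ≤ t)
  set M : Matrix n n ℝ := 2 • centering n - 1 with hMdef
  have hv : ∀ (x : n → ℝ) k, (M *ᵥ x) k = x k - 2 * (Fintype.card n : ℝ)⁻¹ * ∑ l, x l := by
    intro x k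
    rw [hMdef, sub_mulVec, smul_mulVec, one_mulVec, Pi.sub_apply, Pi.smul_apply, centering_mulVec]
    simp only [nsmul_eq_mul]
    push_cast
    ring
  have hcT : (centering n)ᵀ = centering n := by
    ext k l
    simp [centering_apply, eq_comm]
  have hM : M * Mᵀ = 1 := by
    have := Nonempty.intro i
    have h := centering_mul_transpose (n := n)
    rw [hcT] at h
    simp only [hMdef, transpose_sub, transpose_smul, hcT, transpose_one, mul_sub, sub_mul, mul_one,
      one_mul, smul_mul_smul_comm, h]
    module
  have href := setIntegral_stdG_mulVec hM (measurableSet_centeredLE t) (fun x => by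
    simp only [centeredLE, Set.mem_ofPred_eq, centering_mulVec, hv]
    refine forall_congr' fun k => ?_
    rw [Finset.sum_sub_distrib, Finset.sum_const, Finset.card_univ, nsmul_eq_mul]
    have : x k - 2 * (Fintype.card n : ℝ)⁻¹ * ∑ l, x l - (Fintype.card n : ℝ)⁻¹ *
        (∑ l, x l - Fintype.card n * (2 * (Fintype.card n : ℝ)⁻¹ * ∑ l, x l)) =
        x k - (Fintype.card n : ℝ)⁻¹ * ∑ l, x l := by
      field_simp
      ring
    rw [this]) i
  have hi : ∀ k, Integrable (fun x : n → ℝ => x k) ((stdG n).restrict (centeredLE n t)) :=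
    fun k => (integrable_eval_stdG k).restrict
  simp only [hv] at href
  rw [integral_sub (hi i) ((integrable_finsetSum _ fun k _ => hi k).const_mul _),
    integral_const_mul, integral_finsetSum _ fun k _ => hi k] at href
  simp only [hswap, Finset.sum_const, Finset.card_univ, nsmul_eq_mul] at href
  rw [mul_assoc, inv_mul_cancel_left₀ hc] at href
  linarith
end

section
open scoped ENNReal
variable {n : Type} [Fintype n] [DecidableEq n] {A : Type*} [Fintype A] [DecidableEq A]
  {κ : Type*} [Fintype κ]

lemma measurable_mulVec {ι κ : Type*} [Fintype κ] (M : Matrix ι κ ℝ) :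
    Measurable fun x : κ → ℝ => M *ᵥ x :=
  measurable_pi_iff.2 fun i => by simp only [mulVec, dotProduct]; fun_prop

lemma map_uncurry_pi_stdG {n A : Type*} [Fintype n] [Fintype A] :
    (Measure.pi fun _ : A => stdG n).map (fun y (p : A × n) => y p.1 p.2) = stdG (A × n) := by
  have hm : Measurable fun (y : A → n → ℝ) (p : A × n) => y p.1 p.2 :=
    measurable_pi_iff.2 fun p => by fun_prop
  symm
  refine Measure.pi_eq fun s hs => ?_
  rw [Measure.map_apply hm (MeasurableSet.univ_pi hs)]
  have : (fun (y : A → n → ℝ) (p : A × n) => y p.1 p.2) ⁻¹' Set.univ.pi s =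
      Set.univ.pi fun a => Set.univ.pi fun i => s (a, i) := by
    ext y
    simp [Set.mem_pi]
  rw [this, Measure.pi_pi, Fintype.prod_prod_type]
  exact Finset.prod_congr rfl fun a _ => Measure.pi_pi _ _

lemma measure_forall_le_eq_pow (W : Matrix (A × n) κ ℝ) [Nonempty n]
    (hW : W * Wᵀ = Matrix.of fun p q => if p.1 = q.1 then centering n p.2 q.2 else 0) (t : ℝ) :
    stdG κ {g | ∀ p, (W *ᵥ g) p ≤ t} = stdG n (centeredLE n t) ^ Fintype.card A := by
  set C : Matrix (A × n) (A × n) ℝ :=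
    Matrix.of fun p q => if p.1 = q.1 then centering n p.2 q.2 else 0 with hC
  have hCC : C * Cᵀ = C := by
    ext ⟨a, i⟩ ⟨b, j⟩
    have h := congrFun (congrFun (centering_mul_transpose (n := n)) i) j
    rw [mul_apply] at h ⊢
    rw [Fintype.sum_prod_type, Finset.sum_eq_single a]
    · simp only [hC, transpose_apply, of_apply, if_true, mul_ite, mul_zero, eq_comm (a := b)]
      split_ifs
      · exact h
      · simp
    · intro c _ hc
      refine Finset.sum_eq_zero fun k _ => ?_
      simp [hC, hc.symm]
    · simp
  have hlaw : (stdG κ).map (fun g => W *ᵥ g) = (stdG (A × n)).map (fun y => C *ᵥ y) := by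
    have h1 := hasGauss_map_stdG W
    have h2 := hasGauss_map_stdG C
    rw [hW, ← hCC] at h1
    exact h1.ext h2
  have hCv : ∀ (y : A → n → ℝ) (p : A × n),
      (C *ᵥ fun p => y p.1 p.2) p = (centering n *ᵥ y p.1) p.2 := by
    rintro y ⟨a, i⟩
    simp only [mulVec, dotProduct]
    rw [Fintype.sum_prod_type, Finset.sum_eq_single a]
    · simp [hC]
    · intro c _ hc
      refine Finset.sum_eq_zero fun k _ => ?_
      simp [hC, hc.symm]
    · simp
  have hU : MeasurableSet {x : A × n → ℝ | ∀ p, x p ≤ t} :=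
    measurableSet_forall_le (fun p => by fun_prop) fun p => by fun_prop
  have hm : Measurable fun (y : A → n → ℝ) (p : A × n) => y p.1 p.2 :=
    measurable_pi_iff.2 fun p => by fun_prop
  calc stdG κ {g | ∀ p, (W *ᵥ g) p ≤ t}
      = (stdG κ).map (fun g => W *ᵥ g) {x | ∀ p, x p ≤ t} := by
        rw [Measure.map_apply (measurable_mulVec W) hU]; rfl
    _ = (Measure.pi fun _ : A => stdG n) (Set.univ.pi fun _ => centeredLE n t) := by
        rw [hlaw, ← map_uncurry_pi_stdG, Measure.map_map (measurable_mulVec C) hm,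
          Measure.map_apply ((measurable_mulVec C).comp hm) hU]
        congr 1
        ext y
        simp only [Set.mem_preimage, Function.comp_apply, Set.mem_ofPred_eq, hCv, Set.mem_pi,
          Set.mem_univ, true_implies, centeredLE, Prod.forall]
    _ = _ := by rw [Measure.pi_pi, Finset.prod_const, Finset.card_univ]

lemma pow_le_measure_forall_le [Nonempty A] [Nonempty n] (W : Matrix (A × n) κ ℝ)
    (hW : ∀ a i j, (W * Wᵀ) (a, i) (a, j) = centering n i j) (t : ℝ) :
    stdG n (centeredLE n t) ^ Fintype.card A ≤ stdG κ {g | ∀ p, (W *ᵥ g) p ≤ t} := by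
  have hc : (Fintype.card n : ℝ) ≠ 0 := by positivity
  have hsum : ∀ a k, ∑ i, W (a, i) k = 0 := by
    intro a
    have h : ∑ k, (∑ i, W (a, i) k) ^ 2 = 0 := by
      calc ∑ k, (∑ i, W (a, i) k) ^ 2 = ∑ i, ∑ j, (W * Wᵀ) (a, i) (a, j) := by
            simp_rw [mul_apply, transpose_apply, sq, Finset.sum_mul_sum]
            rw [Finset.sum_comm]
            exact Finset.sum_congr rfl fun i _ => Finset.sum_comm
        _ = 0 := by
            refine Finset.sum_eq_zero fun i _ => ?_
            simp [hW, centering_apply, Finset.sum_sub_distrib, hc]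
    intro k
    have := (Finset.sum_eq_zero_iff_of_nonneg fun k _ => sq_nonneg _).1 h k (Finset.mem_univ _)
    exact pow_eq_zero_iff two_ne_zero |>.1 this
  set r : ℝ := √((Fintype.card n : ℝ)⁻¹) with hr
  have hrr : r * r = (Fintype.card n : ℝ)⁻¹ := Real.mul_self_sqrt (by positivity)
  set M : A → Matrix n (κ ⊕ A) ℝ := fun a =>
    Matrix.of fun i => Sum.elim (fun k => W (a, i) k) (fun b => if b = a then r else 0) with hM
  have hMM : ∀ a, M a * (M a)ᵀ = 1 := by
    intro a
    ext i j
    have := hW a i j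
    rw [mul_apply] at this
    rw [mul_apply, Fintype.sum_sum_type]
    simp only [hM, transpose_apply, of_apply, Sum.elim_inl, Sum.elim_inr, mul_ite, mul_zero,
      Finset.sum_ite_eq', Finset.mem_univ, if_true] at this ⊢
    rw [this, centering_apply, hrr, one_apply]
    ring
  have hMv : ∀ a (x : κ ⊕ A → ℝ) i,
      (M a *ᵥ x) i = (W *ᵥ fun k => x (Sum.inl k)) (a, i) + r * x (Sum.inr a) := by
    intro a x i
    simp only [mulVec, dotProduct, Fintype.sum_sum_type, hM, of_apply, Sum.elim_inl, Sum.elim_inr,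
      ite_mul, zero_mul, Finset.sum_ite_eq', Finset.mem_univ, if_true]
  have hWs : ∀ a (g : κ → ℝ), ∑ i, (W *ᵥ g) (a, i) = 0 := by
    intro a g
    simp only [mulVec, dotProduct]
    rw [Finset.sum_comm]
    simp [← Finset.sum_mul, hsum]
  have hcent : ∀ a (x : κ ⊕ A → ℝ) i,
      (centering n *ᵥ (M a *ᵥ x)) i = (W *ᵥ fun k => x (Sum.inl k)) (a, i) := by
    intro a x i
    rw [centering_mulVec]
    simp only [hMv, Finset.sum_add_distrib, hWs, Finset.sum_const, Finset.card_univ, nsmul_eq_mul,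
      zero_add, inv_mul_cancel_left₀ hc, add_sub_cancel_right]
  set T : (κ ⊕ A → ℝ) →L[ℝ] (A → n → ℝ) :=
    ContinuousLinearMap.pi fun a => LinearMap.toContinuousLinearMap (Matrix.mulVecLin (M a)) with hT
  have hTa : ∀ x a, T x a = M a *ᵥ x := fun x a => by
    simp [hT]
  have hmarg : ∀ a, ((stdG (κ ⊕ A)).map T).map (fun y => y a) = stdG n := by
    intro a
    classical
    have h := hasGauss_map_stdG (M a)
    rw [hMM] at h
    rw [Measure.map_map (measurable_pi_apply a) T.measurable]
    simp only [Function.comp_def, hTa]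
    exact h.ext hasGauss_stdG
  have hinl : (stdG (κ ⊕ A)).map (fun x k => x (Sum.inl k)) = stdG κ := by
    classical
    set L : Matrix κ (κ ⊕ A) ℝ := Matrix.of fun k => Sum.elim (fun l => if k = l then 1 else 0) 0
    have hL : L * Lᵀ = 1 := by
      ext k l
      simp [L, mul_apply, one_apply]
    have h := hasGauss_map_stdG L
    rw [hL] at h
    rw [← h.ext hasGauss_stdG]
    congr 1
    ext x k
    simp [L, mulVec, dotProduct]
  have key := pow_measure_polytope_le (A := A) (centering n) (fun _ => t)
    (setIntegral_eval_centeredLE t) ((isCG_stdG (ι := κ ⊕ A)).map T) hmarg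
  refine key.trans_eq ?_
  have hU : MeasurableSet {x : κ → ℝ | ∀ p, (W *ᵥ x) p ≤ t} :=
    measurableSet_forall_le (fun p => (measurable_pi_apply p).comp (measurable_mulVec W))
      fun p => by fun_prop
  have hV : MeasurableSet {y : A → n → ℝ | ∀ a j, (centering n *ᵥ y a) j ≤ t} := by
    rw [Set.ofPred_forall]
    exact MeasurableSet.iInter fun a =>
      (measurableSet_centeredLE t).preimage (measurable_pi_apply a)
  rw [Measure.map_apply T.measurable hV, ← hinl, Measure.map_apply (by fun_prop) hU]
  congr 1
  ext x
  simp only [Set.mem_preimage, Set.mem_ofPred_eq, hTa, hcent, Prod.forall]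
end

section
variable {d : ℕ}

lemma sum_mul_star_eq_trace {n : Type*} [Fintype n] (P : Matrix n n ℂ) {R : Matrix n n ℂ}
    (hR : R.IsHermitian) :
    ∑ p : n × n, P p.1 p.2 * star (R p.1 p.2) = (P * R).trace := by
  simp only [Fintype.sum_prod_type, trace, diag_apply, mul_apply]
  exact Finset.sum_congr rfl fun i _ => Finset.sum_congr rfl fun j _ => by rw [hR.apply]

/-- Parseval's identity for an orthonormal basis of Hermitian matrices. -/
lemma sum_star_trace_mul_trace {ι n : Type*} [Fintype ι] [Fintype n] [DecidableEq ι]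
    [DecidableEq n] (hcard : Fintype.card ι = Fintype.card (n × n)) {G : ι → Matrix n n ℂ}
    (hG : ∀ k, (G k).IsHermitian) (hGG : ∀ k l, (G k * G l).trace = if k = l then (1 : ℂ) else 0)
    {X Y : Matrix n n ℂ} (hX : X.IsHermitian) (hY : Y.IsHermitian) :
    ∑ k, star (G k * X).trace * (G k * Y).trace = (X * Y).trace := by
  set U : Matrix ι (n × n) ℂ := Matrix.of fun k p => G k p.1 p.2 with hU
  have hUU : U * Uᴴ = 1 := by
    ext k l
    simp only [mul_apply, hU, conjTranspose_apply, of_apply]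
    rw [sum_mul_star_eq_trace _ (hG l), hGG, one_apply]
  rw [mul_eq_one_comm_of_card_eq _ _ _ hcard] at hUU
  have hUv : ∀ {Z : Matrix n n ℂ}, Z.IsHermitian →
      U *ᵥ (fun p => star (Z p.1 p.2)) = fun k => (G k * Z).trace := fun hZ =>
    funext fun k => sum_mul_star_eq_trace _ hZ
  have h : star (U *ᵥ fun p => star (X p.1 p.2)) ⬝ᵥ (U *ᵥ fun p => star (Y p.1 p.2)) =
      star (fun p : n × n => star (X p.1 p.2)) ⬝ᵥ fun p => star (Y p.1 p.2) := by
    rw [star_mulVec, ← dotProduct_mulVec, mulVec_mulVec, hUU, one_mulVec]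
  rw [hUv hX, hUv hY] at h
  simp only [dotProduct, Pi.star_apply, star_star] at h
  rw [h, sum_mul_star_eq_trace _ hY]

lemma sum_trace_mul_trace_of_trace_eq_zero {κ : Type*} [Fintype κ] [DecidableEq κ] (hd : d ≠ 0)
    (hκ : Fintype.card κ + 1 = d ^ 2)
    {E : κ → Matrix (Fin d) (Fin d) ℂ} (hE : ∀ k, (E k).IsHermitian) (hE0 : ∀ k, (E k).trace = 0)
    (hEE : ∀ k l, (E k * E l).trace = if k = l then (1 : ℂ) else 0)
    {X Y : Matrix (Fin d) (Fin d) ℂ} (hX : X.IsHermitian) (hY : Y.IsHermitian)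
    (hX0 : X.trace = 0) :
    ∑ k, (E k * X).trace.re * (E k * Y).trace.re = (X * Y).trace.re := by
  set s : ℂ := ((√(d : ℝ) : ℝ) : ℂ)⁻¹ with hs
  have hs1 : star s = s := by simp [hs, ← Complex.ofReal_inv]
  have hs2 : s * s * d = 1 := by
    have h1 : ((√(d : ℝ) : ℝ) : ℂ) * ((√(d : ℝ) : ℝ) : ℂ) = d := by
      rw [← Complex.ofReal_mul, Real.mul_self_sqrt (Nat.cast_nonneg d), Complex.ofReal_natCast]
    rw [hs, ← mul_inv, h1, inv_mul_cancel₀ (Nat.cast_ne_zero.2 hd)]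
  have him : ∀ {Z : Matrix (Fin d) (Fin d) ℂ}, Z.IsHermitian → ∀ k, (E k * Z).trace.im = 0 := by
    intro Z hZ k
    rw [← Complex.conj_eq_iff_im, starRingEnd_apply, ← trace_conjTranspose, conjTranspose_mul, hZ.eq,
      (hE k).eq, trace_mul_comm]
  have h := sum_star_trace_mul_trace (ι := Option κ) (n := Fin d) (by simp [hκ, sq])
    (G := fun o => o.elim (s • 1) E) (fun o => ?_) (fun o o' => ?_) hX hY
  · rw [Fintype.sum_option] at h
    simp only [Option.elim, Matrix.smul_mul, one_mul, trace_smul, hX0, smul_zero, star_zero, zero_mul,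
      zero_add] at h
    rw [← h, Complex.re_sum]
    refine Finset.sum_congr rfl fun k _ => ?_
    rw [Complex.mul_re, him hY k, mul_zero, sub_zero]
    rfl
  · rcases o with _ | k
    · change (s • (1 : Matrix (Fin d) (Fin d) ℂ))ᴴ = _
      rw [conjTranspose_smul, hs1, conjTranspose_one]
      rfl
    · exact hE k
  · rcases o with _ | k <;> rcases o' with _ | l
    · simpa [mul_assoc] using hs2
    · simp [hE0]
    · simp [hE0]
    · simp [hEE]

lemma isHermitian_Qmat (ψ : Fin d → ℂ) : (Qmat ψ).IsHermitian := by
  rw [Qmat]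
  refine IsHermitian.sub ?_ ?_
  · rw [IsHermitian, conjTranspose_vecMulVec, star_star]
  · simp [IsHermitian, conjTranspose_smul]

lemma trace_Qmat (hd : d ≠ 0) {ψ : Fin d → ℂ} (hψ : star ψ ⬝ᵥ ψ = 1) : (Qmat ψ).trace = 0 := by
  have : (d : ℂ) ≠ 0 := Nat.cast_ne_zero.2 hd
  simp [Qmat, trace_vecMulVec, dotProduct_comm ψ, hψ, this]

lemma trace_Qmat_mul_Qmat (hd : d ≠ 0) {ψ φ : Fin d → ℂ} (hψ : star ψ ⬝ᵥ ψ = 1)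
    (hφ : star φ ⬝ᵥ φ = 1) :
    (Qmat ψ * Qmat φ).trace.re = Complex.normSq (star ψ ⬝ᵥ φ) - (d : ℝ)⁻¹ := by
  have h1 : (Qmat ψ * Qmat φ).trace = (Qmat ψ * vecMulVec φ (star φ)).trace := by
    conv_lhs => rw [Qmat.eq_def φ, mul_sub, trace_sub, Matrix.mul_smul, trace_smul, mul_one,
      trace_Qmat hd hψ, smul_zero, sub_zero]
  have h2 : φ ⬝ᵥ star ψ = star ψ ⬝ᵥ φ := dotProduct_comm _ _
  have h3 : φ ⬝ᵥ star φ = 1 := by rw [dotProduct_comm, hφ]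
  have h4 : ψ ⬝ᵥ star φ = star (star ψ ⬝ᵥ φ) := by
    rw [← star_dotProduct_star, star_star, dotProduct_comm]
  rw [h1, Qmat, sub_mul, trace_sub, vecMulVec_mul_vecMulVec, trace_vecMulVec, dotProduct_smul, h4,
    Matrix.smul_mul, trace_smul, one_mul, trace_vecMulVec, h3, smul_eq_mul, smul_eq_mul, mul_one]
  rw [show star (star ψ ⬝ᵥ φ) = starRingEnd ℂ (star ψ ⬝ᵥ φ) from rfl, Complex.mul_conj]
  simp

lemma setOf_ciSup_le_eq (hd : d ≠ 0) {κ Ω : Type*} [Fintype κ] (E : κ → Matrix (Fin d) (Fin d) ℂ)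
    (g : κ → Ω → ℝ) {H : Ω → Matrix (Fin d) (Fin d) ℂ} (hH : ∀ ω, H ω = ∑ k, (g k ω : ℂ) • E k)
    (S : Fin (d + 1) → Fin d → Fin d → ℂ) (t : ℝ) :
    {ω | (⨆ p : Fin (d + 1) × Fin d, ((H ω * Qmat (S p.1 p.2)).trace).re) ≤ t} =
      (fun ω k => g k ω) ⁻¹' {x | ∀ p, ((Matrix.of fun (p : Fin (d + 1) × Fin d) k =>
        (E k * Qmat (S p.1 p.2)).trace.re) *ᵥ x) p ≤ t} := by
  have : NeZero d := ⟨hd⟩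
  ext ω
  rw [Set.mem_ofPred_eq, ciSup_le_iff (Set.finite_range _).bddAbove, Set.mem_preimage,
    Set.mem_ofPred_eq]
  refine forall_congr' fun p => ?_
  simp only [hH, Finset.sum_mul, trace_sum, Complex.re_sum, Matrix.smul_mul, trace_smul, smul_eq_mul,
    Complex.re_ofReal_mul, mulVec, dotProduct, of_apply, mul_comm (g _ ω)]
end

/-- Among labelled unions of `d+1` orthonormal bases, the maximum of the
random-Hamiltonian energies over a complete MUB ensemble stochastically dominates the
maximum over any such union: `P(max_S ≤ t) ≥ P(max_M ≤ t)` for all `t`. -/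
theorem mub_max_stochastic_dominance {d : ℕ} (hd : 2 ≤ d)
    (B : Fin (d + 1) → Fin d → Fin d → ℂ) (hB : IsCompleteMUB B)
    (S : Fin (d + 1) → Fin d → Fin d → ℂ) (hS : ∀ a, IsONB (S a))
    {Ω : Type*} [MeasurableSpace Ω] (μ : Measure Ω) [IsProbabilityMeasure μ]
    (H : Ω → Matrix (Fin d) (Fin d) ℂ) (hH : IsStdGaussianHamiltonian μ H)
    (t : ℝ) :
    μ {ω | (⨆ p : Fin (d + 1) × Fin d, ((H ω * Qmat (B p.1 p.2)).trace).re) ≤ t} ≤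
      μ {ω | (⨆ p : Fin (d + 1) × Fin d, ((H ω * Qmat (S p.1 p.2)).trace).re) ≤ t} := by
  obtain ⟨E, g, hE, hE0, hEE, hg, hlaw, hHg⟩ := hH
  have hd0 : d ≠ 0 := by omega
  have : NeZero d := ⟨hd0⟩
  have hcard : Fintype.card (Fin (d ^ 2 - 1)) + 1 = d ^ 2 := by
    rw [Fintype.card_fin]
    exact Nat.sub_add_cancel (Nat.one_le_pow _ _ (by omega))
  set W : (Fin (d + 1) → Fin d → Fin d → ℂ) → Matrix (Fin (d + 1) × Fin d) (Fin (d ^ 2 - 1)) ℝ :=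
    fun S => Matrix.of fun p k => (E k * Qmat (S p.1 p.2)).trace.re with hW
  have hprob : ∀ S, μ {ω | (⨆ p : Fin (d + 1) × Fin d, ((H ω * Qmat (S p.1 p.2)).trace).re) ≤ t} =
      stdG (Fin (d ^ 2 - 1)) {x | ∀ p, (W S *ᵥ x) p ≤ t} := by
    intro S
    rw [setOf_ciSup_le_eq hd0 E g hHg, stdG, ← hlaw, Measure.map_apply hg]
    exact measurableSet_forall_le
      (fun p => (measurable_pi_apply p).comp (measurable_mulVec _)) fun p => by fun_prop
  have hgram : ∀ S : Fin (d + 1) → Fin d → Fin d → ℂ, (∀ a, IsONB (S a)) → ∀ a b i j,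
      (W S * (W S)ᵀ) (a, i) (b, j) = Complex.normSq (star (S a i) ⬝ᵥ S b j) - (d : ℝ)⁻¹ := by
    intro S hS a b i j
    have hu : ∀ a i, star (S a i) ⬝ᵥ S a i = 1 := fun a i => by simpa using hS a i i
    rw [mul_apply, ← trace_Qmat_mul_Qmat hd0 (hu a i) (hu b j)]
    exact sum_trace_mul_trace_of_trace_eq_zero hd0 hcard hE hE0 hEE (isHermitian_Qmat _)
      (isHermitian_Qmat _) (trace_Qmat hd0 (hu a i))
  have hdiag : ∀ S : Fin (d + 1) → Fin d → Fin d → ℂ, (∀ a, IsONB (S a)) → ∀ a i j,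
      (W S * (W S)ᵀ) (a, i) (a, j) = centering (Fin d) i j := by
    intro S hS a i j
    rw [hgram S hS, hS a, centering_apply, Fintype.card_fin]
    split_ifs <;> simp
  rw [hprob, hprob, measure_forall_le_eq_pow (W B) ?_ t]
  · exact pow_le_measure_forall_le (W S) (hdiag S hS) t
  · ext ⟨a, i⟩ ⟨b, j⟩
    by_cases hab : a = b
    · subst hab
      simp [hdiag B hB.1]
    · rw [hgram B hB.1, hB.2 a b i j hab]
      simp [hab]
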